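/- For every d ≥ 2 there exists ρ_d ∈ (0,1) with the following property: for every ρ ∈ (0, ρ_d] one can find positive constants a_ρ, b_ρ, ε_ρ (depending on ρ and d) such that for all Borel sets E, F ⊆ [0,1]^d and all s ≥ d − ε_ρ, if min{H^s_∞(E), H^s_∞(F)} ≥ 1 − ρ, then Δ(E,F) ⊇ [a_ρ, b_ρ]. Moreover, there exists a dimensional constant c_0 > 0 such that for any κ ∈ (0,1), provided ρ is sufficiently small depending on κ, the parameters can be chosen as a_ρ = ρ^{c_0}, b_ρ = ρ^{c_0 κ}, and ε_ρ = c_0 ρ / log(1/ρ). -/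

import Mathlib

open MeasureTheory Set Metric Filter
open scoped ENNReal NNReal Topology

noncomputable section

abbrev Euc (d : ℕ) : Type := EuclideanSpace ℝ (Fin d)

/-- The closed unit cube `[0,1]^d`. -/
def unitCube (d : ℕ) : Set (Euc d) := {x | ∀ i, x i ∈ Icc (0:ℝ) 1}

/-- The distance set `Δ(E,F) = {|x-y| : x ∈ E, y ∈ F}`. -/
def distSet {d : ℕ} (E F : Set (Euc d)) : Set ℝ :=
  {t | ∃ x ∈ E, ∃ y ∈ F, dist x y = t}

/-- `Q` is a dyadic cube of side length `l`, i.e. `Q = 2^{-k}(m + [0,1]^d)`. -/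
def IsDyadicCube {d : ℕ} (Q : Set (Euc d)) (l : ℝ) : Prop :=
  ∃ (k : ℤ) (m : Fin d → ℤ), l = (2:ℝ) ^ (-k) ∧
    Q = {x | ∀ i, (m i : ℝ) * (2:ℝ) ^ (-k) ≤ x i ∧ x i ≤ ((m i : ℝ) + 1) * (2:ℝ) ^ (-k)}

/-- The `s`-dimensional dyadic Hausdorff content: the infimum of `∑ ℓ(Q_i)^s` over
countable covers of `E` by dyadic cubes. -/
def dyadicContent {d : ℕ} (s : ℝ) (E : Set (Euc d)) : ℝ≥0∞ :=
  ⨅ (Q : ℕ → Set (Euc d)) (l : ℕ → ℝ) (_ : ∀ i, IsDyadicCube (Q i) (l i))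
    (_ : E ⊆ ⋃ i, Q i), ∑' i, ENNReal.ofReal (l i ^ s)

section
/-- point on the unit circle -/
def eI (θ : ℝ) : ℂ := Complex.exp (θ * Complex.I)

lemma eI_cont : Continuous eI := by unfold eI; fun_prop

lemma eI_add (a b : ℝ) : eI (a + b) = eI a * eI b := by
  unfold eI; rw [← Complex.exp_add]; push_cast; ring_nf

lemma eI_periodic : Function.Periodic eI (2 * Real.pi) := by
  intro x; unfold eI
  push_cast
  rw [add_mul, Complex.exp_add]
  simp [Complex.exp_two_pi_mul_I]

lemma norm_eI (θ : ℝ) : ‖eI θ‖ = 1 := by unfold eI; exact Complex.norm_exp_ofReal_mul_I θ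

/-- circle integral of `B` at radius `ρ` -/
def circI (B : ℂ → ℝ) (ρ : ℝ) : ℝ := ∫ α in (-Real.pi)..Real.pi, B (ρ * eI α)

lemma int_shift (F : ℝ → ℝ) (hF : Function.Periodic F (2 * Real.pi)) (φ : ℝ) :
    ∫ α in (-Real.pi)..Real.pi, F (α + φ) = ∫ α in (-Real.pi)..Real.pi, F α := by
  rw [intervalIntegral.integral_comp_add_right (fun x => F x) φ]
  have := hF.intervalIntegral_add_eq (-Real.pi + φ) (-Real.pi)
  convert this using 2 <;> ring

lemma circI_mul (B : ℂ → ℝ) (z : ℂ) :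
    ∫ α in (-Real.pi)..Real.pi, B (z * eI α) = circI B ‖z‖ := by
  unfold circI
  rw [← int_shift (fun α => B (‖z‖ * eI α)) _ (Complex.arg z)]
  · congr 1; ext α
    rw [eI_add, mul_comm (eI α), ← mul_assoc]
    congr 2
    unfold eI
    exact (Complex.norm_mul_exp_arg_mul_I z).symm
  · intro x; simp only [eI_periodic x]

lemma circI_cont (B : ℂ → ℝ) (hB : Continuous B) : Continuous (circI B) := by
  unfold circI
  apply intervalIntegral.continuous_parametric_intervalIntegral_of_continuous'
  have := eI_cont
  unfold Function.uncurry
  fun_prop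

lemma circI_le (B : ℂ → ℝ) (M : ℝ) (hM : ∀ z, |B z| ≤ M) (ρ : ℝ) :
    |circI B ρ| ≤ 2 * Real.pi * M := by
  unfold circI
  have := intervalIntegral.norm_integral_le_of_norm_le_const (a := -Real.pi) (b := Real.pi)
    (f := fun α => B (ρ * eI α)) (C := M) (fun x _ => hM _)
  rw [Real.norm_eq_abs] at this
  refine this.trans (le_of_eq ?_)
  rw [abs_of_pos (by linarith [Real.pi_pos])]; ring

lemma dbl_eq (B : ℂ → ℝ) (hB : Continuous B) :
    ∫ θ in (-Real.pi)..Real.pi, ∫ θ' in (-Real.pi)..Real.pi, B (eI θ - eI θ')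
      = 4 * ∫ β in (0:ℝ)..(Real.pi/2), circI B (2 * Real.sin β) := by
  have hc := eI_cont
  have h1 : ∀ θ, ∫ θ' in (-Real.pi)..Real.pi, B (eI θ - eI θ')
      = ∫ u in (-Real.pi)..Real.pi, B ((1 - eI u) * eI θ) := by
    intro θ
    rw [← int_shift (fun θ' => B (eI θ - eI θ')) _ θ]
    · congr 1; ext u; rw [eI_add]; ring_nf
    · intro x; simp only [eI_periodic x]
  simp_rw [h1]
  rw [intervalIntegral_intervalIntegral_swap]
  swap
  · have : Continuous (Function.uncurry (fun θ u => B ((1 - eI u) * eI θ))) := by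
      unfold Function.uncurry; fun_prop
    have h2 : IntegrableOn (Function.uncurry (fun θ u => B ((1 - eI u) * eI θ)))
        ((uIcc (-Real.pi) Real.pi) ×ˢ (uIcc (-Real.pi) Real.pi)) volume :=
      this.continuousOn.integrableOn_compact (isCompact_uIcc.prod isCompact_uIcc)
    exact h2.mono_set (Set.prod_mono uIoc_subset_uIcc uIoc_subset_uIcc)
  have h3 : ∀ u, ∫ θ in (-Real.pi)..Real.pi, B ((1 - eI u) * eI θ) = circI B (2 * |Real.sin (u/2)|) := by
    intro u
    rw [circI_mul]
    congr 1
    rw [← norm_neg, neg_sub]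
    have := Complex.norm_exp_I_mul_ofReal_sub_one u
    rw [mul_comm] at this
    unfold eI; rw [this, norm_mul]; simp
  simp_rw [h3]
  have hcc := circI_cont B hB
  have hcont : Continuous (fun u => circI B (2 * |Real.sin (u/2)|)) := by
    have := Real.continuous_sin
    fun_prop
  rw [← intervalIntegral.integral_add_adjacent_intervals (b := 0) (hcont.intervalIntegrable _ _) (hcont.intervalIntegrable _ _)]
  have h4 : ∫ u in (-Real.pi)..0, circI B (2 * |Real.sin (u/2)|) = ∫ u in (0:ℝ)..Real.pi, circI B (2 * |Real.sin (u/2)|) := by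
    have := intervalIntegral.integral_comp_neg (a := 0) (b := Real.pi) (fun u => circI B (2 * |Real.sin (u/2)|))
    simp only [neg_zero] at this
    rw [← this]
    congr 1; ext u
    rw [neg_div, Real.sin_neg, abs_neg]
  rw [h4]
  have h5 : ∫ u in (0:ℝ)..Real.pi, circI B (2 * |Real.sin (u/2)|) = 2 * ∫ β in (0:ℝ)..(Real.pi/2), circI B (2 * |Real.sin β|) := by
    have := intervalIntegral.integral_comp_div (a := 0) (b := Real.pi) (c := 2) (fun u => circI B (2 * |Real.sin u|)) (by norm_num)
    rw [this]; simp
  have h6 : ∫ β in (0:ℝ)..(Real.pi/2), circI B (2 * |Real.sin β|) = ∫ β in (0:ℝ)..(Real.pi/2), circI B (2 * Real.sin β) := by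
    apply intervalIntegral.integral_congr
    intro β hβ
    rw [uIcc_of_le (by positivity)] at hβ
    simp only
    rw [abs_of_nonneg (Real.sin_nonneg_of_nonneg_of_le_pi hβ.1 (by linarith [hβ.2, Real.pi_pos]))]
  rw [h5, h6]; ring

/-- truncated radial density -/
def kG (κ n : ℝ) : ℝ := n^2 * (4 - n^2) / (max (Real.sqrt (n^2 * (4 - n^2))) κ)^3

def kK (κ : ℝ) (z : ℂ) : ℝ := kG κ (min ‖z‖ 2)

lemma kG_cont (κ : ℝ) (hκ : 0 < κ) : Continuous (kG κ) := by
  unfold kG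
  apply Continuous.div
  · fun_prop
  · fun_prop
  · intro x; have : 0 < max (Real.sqrt (x^2 * (4 - x^2))) κ := lt_max_of_lt_right hκ
    positivity

lemma kK_cont (κ : ℝ) (hκ : 0 < κ) : Continuous (kK κ) := by
  unfold kK
  exact (kG_cont κ hκ).comp (by fun_prop)

lemma kK_zero (κ : ℝ) (z : ℂ) (hz : 2 ≤ ‖z‖) : kK κ z = 0 := by
  unfold kK kG; rw [min_eq_right hz]; norm_num

lemma qlip (κ q q' : ℝ) (hκ : 0 < κ) (hq : 0 ≤ q) (hqq : q ≤ q') :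
    |q^2 / (max q κ)^3 - q'^2 / (max q' κ)^3| ≤ (q'^2 - q^2) / κ^3 := by
  rcases le_total q' κ with h1 | h1
  · rw [max_eq_right h1, max_eq_right (hqq.trans h1), ← sub_div, abs_div, abs_of_nonpos (by nlinarith), abs_of_pos (by positivity)]
    apply le_of_eq; ring
  · have key : ∀ a b : ℝ, κ ≤ a → a ≤ b → |1/a - 1/b| ≤ (b^2 - a^2)/κ^3 := by
      intro a b ha hb
      have ha0 : 0 < a := by linarith
      have hb0 : 0 < b := by linarith
      rw [abs_of_nonneg (sub_nonneg.2 (one_div_le_one_div_of_le ha0 hb))]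
      rw [div_sub_div _ _ ha0.ne' hb0.ne', div_le_div_iff₀ (by positivity) (by positivity)]
      have h1 : κ^2 ≤ a * b := by nlinarith
      have h2 : κ ≤ a + b := by linarith
      have h3 : κ^3 ≤ (a + b) * (a * b) := by
        calc κ^3 = κ * κ^2 := by ring
          _ ≤ (a+b) * (a*b) := by gcongr
      nlinarith [mul_le_mul_of_nonneg_left h3 (sub_nonneg.2 hb)]
    have sim : ∀ a : ℝ, κ ≤ a → a^2/(max a κ)^3 = 1/a := by
      intro a ha
      have : 0 < a := by linarith
      rw [max_eq_left ha]; field_simp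
    rcases le_total κ q with h2 | h2
    · rw [sim q h2, sim q' h1]; exact key q q' h2 hqq
    · rw [sim q' h1, max_eq_right h2]
      have := key κ q' le_rfl h1
      have h5 : |q^2/κ^3 - 1/κ| = (κ^2 - q^2)/κ^3 := by
        have : q^2/κ^3 - 1/κ = -((κ^2 - q^2)/κ^3) := by field_simp; ring
        rw [this, abs_neg, abs_of_nonneg]
        apply div_nonneg _ (by positivity)
        nlinarith
      calc |q^2/κ^3 - 1/q'| ≤ |q^2/κ^3 - 1/κ| + |1/κ - 1/q'| := abs_sub_le _ _ _
        _ ≤ (κ^2 - q^2)/κ^3 + (q'^2 - κ^2)/κ^3 := by rw [h5]; gcongr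
        _ = _ := by ring

lemma qlip' (κ q q' : ℝ) (hκ : 0 < κ) (hq : 0 ≤ q) (hq' : 0 ≤ q') :
    |q^2 / (max q κ)^3 - q'^2 / (max q' κ)^3| ≤ |q'^2 - q^2| / κ^3 := by
  rcases le_total q q' with h | h
  · exact (qlip κ q q' hκ hq h).trans (by gcongr; exact le_abs_self _)
  · rw [abs_sub_comm, abs_sub_comm (q'^2)]
    exact (qlip κ q' q hκ hq' h).trans (by gcongr; exact le_abs_self _)

lemma kG_lip (κ n m : ℝ) (hκ : 0 < κ) (hn : 0 ≤ n) (hn2 : n ≤ 2) (hm : 0 ≤ m) (hm2 : m ≤ 2) :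
    |kG κ n - kG κ m| ≤ 16 / κ^3 * |n - m| := by
  have h1 : ∀ n : ℝ, 0 ≤ n → n ≤ 2 → 0 ≤ n^2 * (4 - n^2) := by
    intro n h0 h2
    have : n^2 ≤ 4 := by nlinarith
    have := sq_nonneg n
    apply mul_nonneg <;> linarith
  have hs : ∀ n : ℝ, 0 ≤ n → n ≤ 2 → kG κ n = (Real.sqrt (n^2 * (4 - n^2)))^2 / (max (Real.sqrt (n^2 * (4 - n^2))) κ)^3 := by
    intro n h0 h2
    rw [Real.sq_sqrt (h1 n h0 h2)]; rfl
  rw [hs n hn hn2, hs m hm hm2]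
  refine (qlip' κ _ _ hκ (Real.sqrt_nonneg _) (Real.sqrt_nonneg _)).trans ?_
  rw [Real.sq_sqrt (h1 n hn hn2), Real.sq_sqrt (h1 m hm hm2)]
  have : m ^ 2 * (4 - m ^ 2) - n ^ 2 * (4 - n ^ 2) = ((m + n) * (4 - m^2 - n^2)) * (m - n) := by ring
  rw [this, abs_mul, div_mul_eq_mul_div, abs_sub_comm m n]
  gcongr
  rw [abs_mul]
  have h3 : |m + n| ≤ 4 := by rw [abs_le]; constructor <;> linarith
  have h4 : |4 - m^2 - n^2| ≤ 4 := by rw [abs_le]; constructor <;> nlinarith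
  calc |m+n| * |4 - m^2 - n^2| ≤ 4 * 4 := by gcongr
    _ = 16 := by norm_num

lemma kK_lip (κ : ℝ) (hκ : 0 < κ) (z w : ℂ) : |kK κ z - kK κ w| ≤ 16 / κ^3 * ‖z - w‖ := by
  unfold kK
  refine (kG_lip κ _ _ hκ (by positivity) (min_le_right _ _) (by positivity) (min_le_right _ _)).trans ?_
  gcongr
  calc |min ‖z‖ 2 - min ‖w‖ 2| ≤ max |‖z‖ - ‖w‖| |(2:ℝ) - 2| := abs_min_sub_min_le_max _ _ _ _
    _ ≤ ‖z - w‖ := by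
      simp only [sub_self, abs_zero]
      exact max_le (abs_norm_sub_norm_le z w) (norm_nonneg _)

lemma plane_int (κ : ℝ) (hκ : 0 < κ) (B : ℂ → ℝ) (hB : Continuous B) :
    ∫ z, B z * kK κ z = ∫ β in (0:ℝ)..(Real.pi/2),
      (4 * Real.sin β * Real.cos β * kG κ (2 * Real.sin β)) * circI B (2 * Real.sin β) := by
  have hc := eI_cont
  have hk := kG_cont κ hκ
  have hcc := circI_cont B hB
  rw [← Complex.integral_comp_polarCoord_symm]
  have e1 : ∀ p ∈ polarCoord.target, p.1 • (B (Complex.polarCoord.symm p) * kK κ (Complex.polarCoord.symm p))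
      = (fun p : ℝ × ℝ => p.1 * kG κ (min p.1 2) * B (p.1 * eI p.2)) p := by
    intro p hp
    have hp1 : 0 < p.1 := hp.1
    have h1 : Complex.polarCoord.symm p = p.1 * eI p.2 := by
      rw [Complex.polarCoord_symm_apply]; unfold eI
      rw [Complex.exp_mul_I]; push_cast; rfl
    have h2 : ‖(Complex.polarCoord.symm p : ℂ)‖ = p.1 := by
      rw [Complex.norm_polarCoord_symm, abs_of_pos hp1]
    unfold kK
    rw [h2, h1]; simp only [smul_eq_mul]; ring
  rw [setIntegral_congr_fun polarCoord.open_target.measurableSet e1]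
  have e2 : polarCoord.target = Ioi (0:ℝ) ×ˢ Ioo (-Real.pi) Real.pi := rfl
  rw [e2]
  have z1 : ∀ r : ℝ, 2 ≤ r → r * kG κ (min r 2) = 0 := by
    intro r hr; rw [min_eq_right hr]; unfold kG; norm_num
  have hcont : Continuous (fun p : ℝ × ℝ => p.1 * kG κ (min p.1 2) * B (p.1 * eI p.2)) := by fun_prop
  have e3 : ∫ p in Ioi (0:ℝ) ×ˢ Ioo (-Real.pi) Real.pi, p.1 * kG κ (min p.1 2) * B (p.1 * eI p.2)
    = ∫ p in Ioc (0:ℝ) 2 ×ˢ Ioo (-Real.pi) Real.pi, p.1 * kG κ (min p.1 2) * B (p.1 * eI p.2) := by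
    apply setIntegral_eq_of_subset_of_forall_sdiff_eq_zero
    · exact measurableSet_Ioi.prod measurableSet_Ioo
    · exact Set.prod_mono Ioc_subset_Ioi_self le_rfl
    · rintro ⟨r, a⟩ ⟨⟨h1, h2⟩, h3⟩
      have : 2 ≤ r := by
        by_contra hh
        exact h3 ⟨⟨h1, by linarith⟩, h2⟩
      simp only; rw [z1 r this, zero_mul]
  rw [e3, Measure.volume_eq_prod, setIntegral_prod]
  swap
  · have : IntegrableOn (fun p : ℝ × ℝ => p.1 * kG κ (min p.1 2) * B (p.1 * eI p.2))
        (Icc 0 2 ×ˢ Icc (-Real.pi) Real.pi) (volume.prod volume) :=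
      hcont.continuousOn.integrableOn_compact (isCompact_Icc.prod isCompact_Icc)
    exact this.mono_set (Set.prod_mono Ioc_subset_Icc_self Ioo_subset_Icc_self)
  have e4 : ∀ r ∈ Ioc (0:ℝ) 2, ∫ a in Ioo (-Real.pi) Real.pi, r * kG κ (min r 2) * B (r * eI a)
     = r * kG κ r * circI B r := by
    intro r hr
    rw [integral_const_mul, min_eq_left hr.2]
    unfold circI
    rw [intervalIntegral.integral_of_le (by linarith [Real.pi_pos]), integral_Ioc_eq_integral_Ioo]
  simp only
  rw [setIntegral_congr_fun measurableSet_Ioc e4, ← intervalIntegral.integral_of_le (by norm_num)]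
  have e5 := intervalIntegral.integral_comp_mul_deriv (a := 0) (b := Real.pi/2) (f := fun β => 2 * Real.sin β)
    (f' := fun β => 2 * Real.cos β) (g := fun r => r * kG κ r * circI B r)
    (fun x _ => (Real.hasDerivAt_sin x).const_mul 2) (by fun_prop) (by fun_prop)
  simp only [Real.sin_zero, Real.sin_pi_div_two, mul_zero, mul_one] at e5
  rw [← e5]
  congr 1; ext β
  simp only [Function.comp]; ring

/-- weight -/
lemma psi_bd (κ : ℝ) (hκ : 0 < κ) (β : ℝ) (h0 : 0 ≤ β) (h1 : β ≤ Real.pi/2) :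
    0 ≤ 1 - 4 * Real.sin β * Real.cos β * kG κ (2 * Real.sin β) ∧
    1 - 4 * Real.sin β * Real.cos β * kG κ (2 * Real.sin β) ≤ 1 ∧
    (κ ≤ β → β ≤ Real.pi/2 - κ → 1 - 4 * Real.sin β * Real.cos β * kG κ (2 * Real.sin β) = 0) := by
  have hs : 0 ≤ Real.sin β := Real.sin_nonneg_of_nonneg_of_le_pi h0 (by linarith [Real.pi_pos])
  have hco : 0 ≤ Real.cos β := Real.cos_nonneg_of_mem_Icc ⟨by linarith [Real.pi_pos], h1⟩
  set q := 4 * Real.sin β * Real.cos β with hq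
  have hq0 : 0 ≤ q := by positivity
  have hqq : (2 * Real.sin β)^2 * (4 - (2 * Real.sin β)^2) = q^2 := by
    have := Real.sin_sq_add_cos_sq β
    rw [hq]
    have h2 : 4 - (2 * Real.sin β)^2 = 4 * Real.cos β^2 := by nlinarith
    rw [h2]; ring
  have hk : kG κ (2 * Real.sin β) = q^2 / (max q κ)^3 := by
    unfold kG; rw [hqq, Real.sqrt_sq hq0]
  rw [hk]
  have hm : 0 < max q κ := lt_max_of_lt_right hκ
  have hle : q * (q^2 / (max q κ)^3) = (q / max q κ)^3 := by field_simp
  have hd : q / max q κ ≤ 1 := (div_le_one hm).2 (le_max_left _ _)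
  have hd0 : 0 ≤ q / max q κ := by positivity
  rw [hle]
  refine ⟨by linarith [pow_le_one₀ hd0 hd (n := 3)], by linarith [pow_nonneg hd0 3], ?_⟩
  intro ha hb
  have hqk : κ ≤ q := by
    have hsin : Real.sin β * (Real.pi) ≥ 2 * β := by
      have := Real.mul_le_sin h0 h1
      have hp := Real.pi_pos
      have h := mul_le_mul_of_nonneg_right this hp.le
      field_simp at h
      linarith
    have hcos : Real.cos β * Real.pi ≥ 2 * (Real.pi/2 - β) := by
      have := Real.mul_le_sin (x := Real.pi/2 - β) (by linarith) (by linarith)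
      rw [Real.sin_pi_div_two_sub] at this
      have hp := Real.pi_pos
      have h := mul_le_mul_of_nonneg_right this hp.le
      field_simp at h
      linarith
    have hpi : Real.pi ≤ 4 := Real.pi_le_four
    have hpi3 := Real.pi_gt_three
    have hsin' : β ≤ 2 * Real.sin β := by nlinarith
    have hcos' : Real.pi/2 - β ≤ 2 * Real.cos β := by nlinarith
    rw [hq]
    have : β * (Real.pi/2 - β) ≤ (2 * Real.sin β) * (2 * Real.cos β) := by
      apply mul_le_mul hsin' hcos' (by linarith) (by positivity)
    rcases le_total β 1 with hb1 | hb1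
    · -- pi/2 - β ≥ ... use both
      have hc1 : (1:ℝ)/2 ≤ Real.cos β := by
        have : Real.cos 1 ≤ Real.cos β := Real.cos_le_cos_of_nonneg_of_le_pi h0 (by linarith) hb1
        have h9 := Real.one_sub_sq_div_two_le_cos (x := 1); linarith
      nlinarith
    · have hs1 : (1:ℝ)/2 ≤ Real.sin β := by nlinarith
      nlinarith
  rw [max_eq_left hqk, div_self (by linarith)]; norm_num

end

section
lemma trunc_err (κ : ℝ) (hκ : 0 < κ) (hκ2 : κ ≤ 1/2) (B : ℂ → ℝ) (hB : Continuous B) (M : ℝ)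
    (hM : ∀ z, |B z| ≤ M) :
    |(∫ β in (0:ℝ)..(Real.pi/2), circI B (2 * Real.sin β)) - ∫ z, B z * kK κ z| ≤ 4 * Real.pi * M * κ := by
  have hpi := Real.pi_gt_three
  have hM0 : 0 ≤ M := (abs_nonneg _).trans (hM 0)
  have hcc := circI_cont B hB
  have hk := kG_cont κ hκ
  rw [plane_int κ hκ B hB]
  have hc1 : Continuous (fun β => circI B (2 * Real.sin β)) := by fun_prop
  have hc2 : Continuous (fun β => (4 * Real.sin β * Real.cos β * kG κ (2 * Real.sin β)) * circI B (2 * Real.sin β)) := by fun_prop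
  rw [← intervalIntegral.integral_sub (hc1.intervalIntegrable _ _) (hc2.intervalIntegrable _ _)]
  set G : ℝ → ℝ := fun β => circI B (2 * Real.sin β) - (4 * Real.sin β * Real.cos β * kG κ (2 * Real.sin β)) * circI B (2 * Real.sin β) with hG
  have hGc : Continuous G := hc1.sub hc2
  have hGe : ∀ β, G β = (1 - 4 * Real.sin β * Real.cos β * kG κ (2 * Real.sin β)) * circI B (2 * Real.sin β) := by
    intro β; simp only [hG]; ring
  have hb : ∀ β, 0 ≤ β → β ≤ Real.pi/2 → ‖G β‖ ≤ 2 * Real.pi * M := by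
    intro β h0 h1
    obtain ⟨p1, p2, -⟩ := psi_bd κ hκ β h0 h1
    rw [hGe, norm_mul, Real.norm_eq_abs, Real.norm_eq_abs, abs_of_nonneg p1]
    calc _ ≤ 1 * (2 * Real.pi * M) := by
          apply mul_le_mul p2 (circI_le B M hM _) (abs_nonneg _) (by norm_num)
      _ = _ := by ring
  have s1 := intervalIntegral.integral_add_adjacent_intervals (a := 0) (b := κ) (c := Real.pi/2 - κ) (hGc.intervalIntegrable _ _) (hGc.intervalIntegrable (μ := volume) _ _)
  have s2 := intervalIntegral.integral_add_adjacent_intervals (a := 0) (b := Real.pi/2 - κ) (c := Real.pi/2) (hGc.intervalIntegrable _ _) (hGc.intervalIntegrable (μ := volume) _ _)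
  have i2 : ∫ β in κ..(Real.pi/2 - κ), G β = 0 := by
    apply intervalIntegral.integral_zero_ae
    filter_upwards with β hβ
    rw [uIoc_of_le (by linarith)] at hβ
    rw [hGe, (psi_bd κ hκ β (by linarith [hβ.1]) (by linarith [hβ.2])).2.2 hβ.1.le hβ.2, zero_mul]
  have i1 := intervalIntegral.norm_integral_le_of_norm_le_const (a := 0) (b := κ) (f := G) (C := 2 * Real.pi * M) (by
    intro β hβ
    rw [uIoc_of_le (by linarith)] at hβ
    exact hb β hβ.1.le (by linarith [hβ.2]))
  have i3 := intervalIntegral.norm_integral_le_of_norm_le_const (a := Real.pi/2 - κ) (b := Real.pi/2) (f := G) (C := 2 * Real.pi * M) (by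
    intro β hβ
    rw [uIoc_of_le (by linarith)] at hβ
    exact hb β (by linarith [hβ.1]) hβ.2)
  rw [← s2, ← s1, i2, add_zero]
  refine (abs_add_le _ _).trans ?_
  rw [Real.norm_eq_abs] at i1 i3
  have e1 : |κ - 0| = κ := by rw [sub_zero, abs_of_pos hκ]
  have e3 : |Real.pi/2 - (Real.pi/2 - κ)| = κ := by rw [sub_sub_cancel, abs_of_pos hκ]
  rw [e1] at i1; rw [e3] at i3
  linarith

lemma shift_err (κ : ℝ) (hκ : 0 < κ) (B : ℂ → ℝ) (hB : Continuous B) (M : ℝ)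
    (hM : ∀ z, |B z| ≤ M) (w : ℂ) (hw : ‖w‖ ≤ 1) :
    |(∫ z, B z * kK κ z) - ∫ z, B (z + w) * kK κ z| ≤ 16 / κ^3 * ‖w‖ * M * volume.real (closedBall (0:ℂ) 3) := by
  have hM0 : 0 ≤ M := (abs_nonneg _).trans (hM 0)
  have hk := kK_cont κ hκ
  have e1 : ∫ z, B (z + w) * kK κ z = ∫ z, B z * kK κ (z - w) := by
    rw [← integral_add_right_eq_self (fun z => B z * kK κ (z - w)) w]
    simp
  have zz : ∀ z, z ∉ closedBall (0:ℂ) 3 → kK κ z = 0 ∧ kK κ (z - w) = 0 := by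
    intro z hz
    have : 3 < ‖z‖ := by simpa using hz
    refine ⟨kK_zero κ z (by linarith), kK_zero κ _ ?_⟩
    have := norm_sub_norm_le z w
    linarith
  have I1 : Integrable (fun z => B z * kK κ z) := by
    apply Continuous.integrable_of_hasCompactSupport (by fun_prop)
    apply HasCompactSupport.intro (isCompact_closedBall (0:ℂ) 3)
    intro z hz; simp [(zz z hz).1]
  have I2 : Integrable (fun z => B z * kK κ (z - w)) := by
    apply Continuous.integrable_of_hasCompactSupport (by fun_prop)
    apply HasCompactSupport.intro (isCompact_closedBall (0:ℂ) 3)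
    intro z hz; simp [(zz z hz).2]
  rw [e1, ← integral_sub I1 I2, ← setIntegral_eq_integral_of_forall_compl_eq_zero (s := closedBall (0:ℂ) 3)]
  · have := norm_setIntegral_le_of_norm_le_const (μ := volume) (s := closedBall (0:ℂ) 3) (f := fun z => B z * kK κ z - B z * kK κ (z - w)) (C := 16 / κ^3 * ‖w‖ * M) measure_closedBall_lt_top (by
      intro z _
      rw [← mul_sub, norm_mul, mul_comm]
      apply mul_le_mul _ (hM z) (abs_nonneg _) (by positivity)
      have := kK_lip κ hκ z (z - w)
      rwa [sub_sub_cancel] at this)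
    exact this
  · intro z hz; simp [zz z hz]

/-- the double circle integral -/
def dblI (B : ℂ → ℝ) : ℝ := ∫ θ in (-Real.pi)..Real.pi, ∫ θ' in (-Real.pi)..Real.pi, B (eI θ - eI θ')

lemma dblI_le (B : ℂ → ℝ) (M : ℝ) (hM : ∀ z, |B z| ≤ M) : |dblI B| ≤ 2 * Real.pi * (2 * Real.pi * M) := by
  unfold dblI
  have hp : |Real.pi - -Real.pi| = 2 * Real.pi := by rw [abs_of_pos (by linarith [Real.pi_pos])]; ring
  have := intervalIntegral.norm_integral_le_of_norm_le_const (a := -Real.pi) (b := Real.pi)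
    (f := fun θ => ∫ θ' in (-Real.pi)..Real.pi, B (eI θ - eI θ')) (C := 2 * Real.pi * M) (fun x _ => by
      have := intervalIntegral.norm_integral_le_of_norm_le_const (a := -Real.pi) (b := Real.pi)
        (f := fun θ' => B (eI x - eI θ')) (C := M) (fun x _ => hM _)
      rw [hp] at this; linarith)
  rw [hp, Real.norm_eq_abs] at this; linarith

lemma two_dim : ∃ C : ℝ, 0 < C ∧ ∀ (B : ℂ → ℝ) (M : ℝ), Continuous B → (∀ z, |B z| ≤ M) → ∀ w : ℂ,
    |dblI B - dblI (fun z => B (z + w))| ≤ C * M * ‖w‖ ^ (1/4 : ℝ) := by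
  set V := volume.real (closedBall (0:ℂ) 3)
  have hV : 0 ≤ V := measureReal_nonneg
  have hpi := Real.pi_pos
  refine ⟨16 * Real.pi^2 + 32 * Real.pi + 64 * V, by positivity, ?_⟩
  intro B M hB hM w
  have hM0 : 0 ≤ M := (abs_nonneg _).trans (hM 0)
  by_cases hw0 : w = 0
  · subst hw0; simp
  have hwp : 0 < ‖w‖ := norm_pos_iff.2 hw0
  set κ := ‖w‖ ^ (1/4 : ℝ) with hκd
  have hκ : 0 < κ := by positivity
  have hk4 : κ^4 = ‖w‖ := by
    rw [hκd, ← Real.rpow_natCast, ← Real.rpow_mul (norm_nonneg _)]; norm_num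
  by_cases hk : κ ≤ 1/2
  · have hw1 : ‖w‖ ≤ 1 := by rw [← hk4]; exact pow_le_one₀ hκ.le (by linarith)
    unfold dblI
    rw [dbl_eq B hB, dbl_eq (fun z => B (z + w)) (by fun_prop)]
    have a1 := trunc_err κ hκ hk B hB M hM
    have a2 := trunc_err κ hκ hk (fun z => B (z + w)) (by fun_prop) M (fun z => hM _)
    have a3 := shift_err κ hκ B hB M hM w hw1
    have e : 16 / κ^3 * ‖w‖ = 16 * κ := by rw [← hk4]; field_simp
    rw [e] at a3
    rw [abs_le] at a1 a2 a3 ⊢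
    have hx : 0 ≤ Real.pi^2 * M * κ := by positivity
    constructor <;> nlinarith
  · push Not at hk
    have a1 := dblI_le B M hM
    have a2 := dblI_le (fun z => B (z + w)) M (fun z => hM _)
    refine (abs_sub _ _).trans ?_
    have h1 : 0 ≤ Real.pi^2 * M := by positivity
    have h2 : 0 ≤ Real.pi * M * κ := by positivity
    have h3 : 0 ≤ V * M * κ := by positivity
    nlinarith

end

section
variable {H : Type*} [NormedAddCommGroup H] [InnerProductSpace ℝ H] [CompleteSpace H]

lemma circ_avg : ∃ C : ℝ, 0 < C ∧ ∀ {H : Type} [NormedAddCommGroup H] [InnerProductSpace ℝ H] [CompleteSpace H] (V : ℂ → H →ₗᵢ[ℝ] H),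
    (∀ a b f, V (a + b) f = V a (V b f)) → (∀ f, Continuous (fun z => V z f)) →
    ∀ (g : H) (w ζ : ℂ), ζ ≠ 0 →
    ‖∫ θ in (-Real.pi)..Real.pi, V (eI θ * ζ) (g - V w g)‖ ≤ C * (‖w‖ / ‖ζ‖) ^ (1/8 : ℝ) * ‖g‖ := by
  obtain ⟨C, hC, h2⟩ := two_dim
  refine ⟨Real.sqrt (2 * C), by positivity, ?_⟩
  intro H _ _ _ V hV hVc g w ζ hζ
  have hc := eI_cont
  set f := g - V w g with hf
  set F : ℝ → H := fun θ => V (eI θ * ζ) f with hF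
  have hFc : Continuous F := (hVc f).comp (by fun_prop)
  set B0 : ℂ → ℝ := fun ξ => inner ℝ (V ξ g) f with hB0
  have hB0c : Continuous B0 := (hVc g).inner continuous_const
  have hfn : ‖f‖ ≤ 2 * ‖g‖ := by
    calc ‖f‖ ≤ ‖g‖ + ‖V w g‖ := norm_sub_le _ _
      _ = 2 * ‖g‖ := by rw [(V w).norm_map]; ring
  set B : ℂ → ℝ := fun z => B0 (z * ζ) with hB
  have hBc : Continuous B := hB0c.comp (by fun_prop)
  have hBM : ∀ z, |B z| ≤ 2 * ‖g‖^2 := by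
    intro z
    calc |B z| ≤ ‖V (z * ζ) g‖ * ‖f‖ := abs_real_inner_le_norm _ _
      _ ≤ ‖g‖ * (2 * ‖g‖) := by rw [(V _).norm_map]; gcongr
      _ = _ := by ring
  have key : ∀ θ θ', inner ℝ (F θ) (F θ') = B (eI θ - eI θ') - B (eI θ - eI θ' + w/ζ) := by
    intro θ θ'
    have e1 : F θ = V (eI θ' * ζ) (V ((eI θ - eI θ') * ζ) f) := by
      rw [hF, ← hV]; simp only; congr 2; ring
    have e2 : F θ' = V (eI θ' * ζ) f := rfl
    rw [e1, e2, LinearIsometry.inner_map_map]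
    have e3 : V ((eI θ - eI θ') * ζ) f = V ((eI θ - eI θ') * ζ) g - V ((eI θ - eI θ' + w/ζ) * ζ) g := by
      rw [hf, map_sub, ← hV]; congr 3; field_simp
    rw [e3, inner_sub_left]
  have hint : ∀ x : H, ∫ θ in (-Real.pi)..Real.pi, inner ℝ x (F θ) = inner ℝ x (∫ θ in (-Real.pi)..Real.pi, F θ) := by
    intro x
    exact (innerSL ℝ x).intervalIntegral_comp_comm (hFc.intervalIntegrable _ _)
  have hsq : ‖∫ θ in (-Real.pi)..Real.pi, F θ‖^2 = dblI B - dblI (fun z => B (z + w/ζ)) := by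
    rw [← real_inner_self_eq_norm_sq, ← hint]
    have : ∀ θ, inner ℝ (∫ θ in (-Real.pi)..Real.pi, F θ) (F θ) = (∫ θ' in (-Real.pi)..Real.pi, B (eI θ - eI θ')) - ∫ θ' in (-Real.pi)..Real.pi, B (eI θ - eI θ' + w/ζ) := by
      intro θ
      rw [real_inner_comm, ← hint]
      simp_rw [key]
      rw [intervalIntegral.integral_sub] <;> exact Continuous.intervalIntegrable (by fun_prop) _ _
    simp_rw [this]
    have hcc : ∀ u : ℂ, Continuous (fun θ => ∫ θ' in (-Real.pi)..Real.pi, B (eI θ - eI θ' + u)) := by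
      intro u
      apply intervalIntegral.continuous_parametric_intervalIntegral_of_continuous'
      unfold Function.uncurry
      fun_prop
    have h0 := hcc 0
    simp only [add_zero] at h0
    rw [intervalIntegral.integral_sub (h0.intervalIntegrable _ _) ((hcc _).intervalIntegrable _ _)]
    rfl
  have hfin := h2 B (2 * ‖g‖^2) hBc hBM (w/ζ)
  rw [← hsq, abs_of_nonneg (by positivity), norm_div] at hfin
  apply le_of_sq_le_sq _ (by positivity)
  refine hfin.trans (le_of_eq ?_)
  rw [mul_pow, mul_pow, Real.sq_sqrt (by positivity), ← Real.rpow_natCast (_ ^ (1/8:ℝ)), ← Real.rpow_mul (by positivity)]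
  norm_num; ring

end

section
variable {d : ℕ}

def plP (i k : Fin d) : ℂ →ₗ[ℝ] Euc d where
  toFun ζ := ζ.re • EuclideanSpace.single i (1:ℝ) + ζ.im • EuclideanSpace.single k (1:ℝ)
  map_add' a b := by simp only [Complex.add_re, Complex.add_im, add_smul]; abel
  map_smul' c a := by simp [smul_add, mul_smul]

def plQ (i k : Fin d) : Euc d →ₗ[ℝ] ℂ where
  toFun z := ⟨z i, z k⟩
  map_add' a b := by apply Complex.ext <;> simp
  map_smul' c a := by apply Complex.ext <;> simp

lemma inner_plP (i k : Fin d) (a : Euc d) (ξ : ℂ) : inner ℝ a (plP i k ξ) = ξ.re * a i + ξ.im * a k := by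
  simp [plP, inner_add_right, inner_smul_right, EuclideanSpace.inner_single_right]

lemma plP_norm (i k : Fin d) (hik : i ≠ k) (ξ : ℂ) : ‖plP i k ξ‖ = ‖ξ‖ := by
  have h : ‖plP i k ξ‖^2 = ‖ξ‖^2 := by
    rw [← real_inner_self_eq_norm_sq, inner_plP, Complex.sq_norm, Complex.normSq_apply]
    simp [plP, hik, hik.symm]
  exact (sq_eq_sq₀ (norm_nonneg _) (norm_nonneg _)).1 h

lemma plQP (i k : Fin d) (hik : i ≠ k) (ξ : ℂ) : plQ i k (plP i k ξ) = ξ := by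
  apply Complex.ext <;> simp [plP, plQ, hik, hik.symm]

lemma perp_norm (i k : Fin d) (hik : i ≠ k) (z : Euc d) (ξ : ℂ) :
    ‖z - plP i k (plQ i k z) + plP i k ξ‖^2 = ‖z - plP i k (plQ i k z)‖^2 + ‖ξ‖^2 := by
  have h : plQ i k (z - plP i k (plQ i k z)) = 0 := by rw [map_sub, plQP i k hik, sub_self]
  have h1 : (z - plP i k (plQ i k z)) i = 0 := congrArg Complex.re h
  have h2 : (z - plP i k (plQ i k z)) k = 0 := congrArg Complex.im h
  rw [norm_add_sq_real, inner_plP, h1, h2, plP_norm i k hik]; ring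

def rotL (i k : Fin d) (hik : i ≠ k) (θ : ℝ) : Euc d →ₗᵢ[ℝ] Euc d where
  toLinearMap := LinearMap.id - (plP i k) ∘ₗ (plQ i k) + (plP i k) ∘ₗ (LinearMap.mulLeft ℝ (eI θ)) ∘ₗ (plQ i k)
  norm_map' z := by
    simp only [LinearMap.add_apply, LinearMap.sub_apply, LinearMap.id_apply, LinearMap.comp_apply, LinearMap.mulLeft_apply]
    have h := perp_norm i k hik z (eI θ * plQ i k z)
    have h2 := perp_norm i k hik z (plQ i k z)
    rw [sub_add_cancel] at h2
    rw [norm_mul, norm_eI, one_mul, ← h2] at h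
    exact (sq_eq_sq₀ (norm_nonneg _) (norm_nonneg _)).1 h

lemma rotL_apply (i k : Fin d) (hik : i ≠ k) (θ : ℝ) (z : Euc d) :
    rotL i k hik θ z = (z - plP i k (plQ i k z)) + plP i k (eI θ * plQ i k z) := rfl

/-- uniform probability on the unit ball -/
def ballM (d : ℕ) : Measure (Euc d) := (volume (ball (0 : Euc d) 1))⁻¹ • volume.restrict (ball 0 1)

def radP (t : ℝ) (w : Euc d) : Euc d := (t / ‖w‖) • w

lemma radP_meas (t : ℝ) : Measurable (radP t : Euc d → Euc d) := by
  unfold radP; fun_prop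

def sphM (d : ℕ) (t : ℝ) : Measure (Euc d) := (ballM d).map (radP t)

instance : IsProbabilityMeasure (ballM d) := by
  constructor
  unfold ballM
  rw [Measure.smul_apply, Measure.restrict_apply MeasurableSet.univ, univ_inter, smul_eq_mul]
  exact ENNReal.inv_mul_cancel (measure_ball_pos _ _ one_pos).ne' measure_ball_lt_top.ne

instance (t : ℝ) : IsProbabilityMeasure (sphM d t) := Measure.isProbabilityMeasure_map (radP_meas t).aemeasurable

lemma ballM_inv (R : Euc d ≃ₗᵢ[ℝ] Euc d) : (ballM d).map R = ballM d := by
  unfold ballM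
  rw [Measure.map_smul]
  congr 1
  have h := (R.measurePreserving).restrict_preimage (measurableSet_ball (x := (0 : Euc d)) (ε := 1))
  have e : R ⁻¹' (ball 0 1) = ball 0 1 := by ext z; simp
  rw [e] at h
  exact h.map_eq

lemma sphM_inv (R : Euc d ≃ₗᵢ[ℝ] Euc d) (t : ℝ) : (sphM d t).map R = sphM d t := by
  unfold sphM
  rw [Measure.map_map R.continuous.measurable (radP_meas t)]
  have e : R ∘ radP t = (radP t) ∘ R := by
    ext1 w; simp [radP]
  rw [e, ← Measure.map_map (radP_meas t) R.continuous.measurable, ballM_inv]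

lemma ballM_ae_ne (hd : 2 ≤ d) : ∀ᵐ w ∂(ballM d), w ≠ 0 := by
  haveI : Nonempty (Fin d) := ⟨⟨0, by omega⟩⟩
  unfold ballM
  apply Measure.ae_smul_measure
  apply ae_restrict_of_ae
  rw [ae_iff]; simp

lemma sphM_ae (hd : 2 ≤ d) (t : ℝ) (ht : 0 < t) : ∀ᵐ z ∂(sphM d t), ‖z‖ = t := by
  unfold sphM
  rw [ae_map_iff (radP_meas t).aemeasurable (by measurability)]
  filter_upwards [ballM_ae_ne hd] with w hw
  have : 0 < ‖w‖ := norm_pos_iff.2 hw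
  unfold radP
  rw [norm_smul, norm_div, norm_norm, Real.norm_of_nonneg ht.le]
  field_simp

lemma slab_vol (i : Fin d) (κ : ℝ) (hκ : 0 ≤ κ) :
    volume {w : Euc d | ‖w‖ < 1 ∧ |w i| ≤ κ} ≤ ENNReal.ofReal (2^d * κ) := by
  have h1 : {w : Euc d | ‖w‖ < 1 ∧ |w i| ≤ κ} ⊆ (@WithLp.ofLp 2 (Fin d → ℝ)) ⁻¹' (Set.pi univ (fun j => if j = i then Icc (-κ) κ else Icc (-1:ℝ) 1)) := by
    rintro w ⟨h, h'⟩ j -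
    simp only
    split_ifs with hj
    · subst hj; exact abs_le.1 h'
    · have := PiLp.norm_apply_le w j
      exact abs_le.1 (this.trans h.le)
  refine (measure_mono h1).trans ?_
  rw [(PiLp.volume_preserving_ofLp (Fin d)).measure_preimage]
  · rw [volume_pi_pi]
    have : ∀ j : Fin d, volume (if j = i then Icc (-κ) κ else Icc (-1:ℝ) 1) = ENNReal.ofReal (2 * (if j = i then κ else 1)) := by
      intro j; split_ifs <;> rw [Real.volume_Icc] <;> ring_nf
    simp_rw [this]
    rw [← ENNReal.ofReal_prod_of_nonneg]
    · rw [Finset.prod_mul_distrib]; simp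
    · intro j _; split_ifs <;> linarith
  · apply MeasurableSet.nullMeasurableSet
    apply MeasurableSet.univ_pi
    intro j; split_ifs <;> exact measurableSet_Icc

lemma sphM_slab (hd : 2 ≤ d) : ∃ C : ℝ, 0 < C ∧ ∀ (i : Fin d) (t κ : ℝ), 0 < t → 0 ≤ κ →
    (sphM d t).real {z | |z i| ≤ κ * t} ≤ C * κ := by
  have hv : 0 < volume.real (ball (0 : Euc d) 1) := by
    rw [measureReal_def]
    exact ENNReal.toReal_pos (measure_ball_pos _ _ one_pos).ne' measure_ball_lt_top.ne
  refine ⟨2^d * (volume.real (ball (0 : Euc d) 1))⁻¹, by positivity, ?_⟩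
  intro i t κ ht hκ
  have hm : MeasurableSet {z : Euc d | |z i| ≤ κ * t} := by
    apply measurableSet_le <;> fun_prop
  have h1 : sphM d t {z | |z i| ≤ κ * t} ≤ (volume (ball (0 : Euc d) 1))⁻¹ * ENNReal.ofReal (2^d * κ) := by
    unfold sphM
    rw [Measure.map_apply (radP_meas t) hm]
    unfold ballM
    rw [Measure.smul_apply, smul_eq_mul]
    gcongr
    rw [Measure.restrict_apply (radP_meas t hm)]
    refine (measure_mono ?_).trans (slab_vol i κ hκ)
    rintro w ⟨h1, h2⟩
    have h2' : ‖w‖ < 1 := by simpa using h2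
    refine ⟨h2', ?_⟩
    simp only [radP, mem_preimage, mem_setOf_eq, PiLp.smul_apply, smul_eq_mul, abs_mul, abs_div, abs_norm, abs_of_pos ht] at h1
    by_cases hw : w = 0
    · subst hw; simpa using hκ
    have : 0 < ‖w‖ := norm_pos_iff.2 hw
    rw [div_mul_eq_mul_div, div_le_iff₀ this] at h1
    have h3 : |w i| ≤ κ * ‖w‖ := by nlinarith
    nlinarith
  rw [measureReal_def]
  refine (ENNReal.toReal_mono ?_ h1).trans (le_of_eq ?_)
  · exact ENNReal.mul_ne_top (ENNReal.inv_ne_top.2 (measure_ball_pos _ _ one_pos).ne') ENNReal.ofReal_ne_top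
  · rw [ENNReal.toReal_mul, ENNReal.toReal_inv, ENNReal.toReal_ofReal (by positivity), measureReal_def]; ring

end

section
variable {d : ℕ}

lemma op_decay (hd : 2 ≤ d) (t1 : ℝ) (ht1 : 0 < t1) : ∃ C : ℝ, 0 < C ∧
    ∀ {H : Type} [NormedAddCommGroup H] [InnerProductSpace ℝ H] [CompleteSpace H] (U : Euc d → H →ₗᵢ[ℝ] H),
    (∀ a b f, U (a + b) f = U a (U b f)) → (∀ f, Continuous (fun z => U z f)) →
    ∀ (t : ℝ), t1 ≤ t → ∀ (g : H) (i : Fin d) (h : ℝ), |h| ≤ 1 →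
    ‖∫ z, U z (g - U (h • EuclideanSpace.single i (1:ℝ)) g) ∂(sphM d t)‖ ≤ C * |h| ^ (1/16 : ℝ) * ‖g‖ := by
  obtain ⟨C1, hC1, hcirc⟩ := circ_avg
  obtain ⟨C2, hC2, hslab⟩ := sphM_slab hd
  refine ⟨4 * Real.pi * C2 + C1 * (1/t1)^(1/8:ℝ), by positivity, ?_⟩
  intro H _ _ _ U hU hUc t ht g i h hh
  have ht0 : 0 < t := by linarith
  by_cases h0 : h = 0
  · have : U ((0:ℝ) • EuclideanSpace.single i (1:ℝ)) g = g := by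
      have h1 := hU 0 0 g
      rw [add_zero] at h1
      rw [zero_smul]
      exact ((U 0).injective h1).symm
    subst h0
    rw [this]; simp
  have hhp : 0 < |h| := abs_pos.2 h0
  obtain ⟨k, hik⟩ : ∃ k : Fin d, i ≠ k := by
    have : Nontrivial (Fin d) := Fin.nontrivial_iff_two_le.2 hd
    obtain ⟨k, hk⟩ := exists_ne i
    exact ⟨k, hk.symm⟩
  have hPc : Continuous (plP i k) := LinearMap.continuous_of_finiteDimensional _
  have hQc : Continuous (plQ i k) := LinearMap.continuous_of_finiteDimensional _
  have hc := eI_cont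
  set f := g - U (h • EuclideanSpace.single i (1:ℝ)) g with hf
  have hfw : f = g - U (plP i k (h:ℂ)) g := by
    rw [hf]; congr 3; simp [plP]
  have hfn : ‖f‖ ≤ 2 * ‖g‖ := by
    calc ‖f‖ ≤ ‖g‖ + ‖U _ g‖ := norm_sub_le _ _
      _ = 2 * ‖g‖ := by rw [(U _).norm_map]; ring
  set σ := sphM d t with hσ
  set V : ℂ → H →ₗᵢ[ℝ] H := fun ξ => U (plP i k ξ) with hVd
  have hV : ∀ a b f, V (a + b) f = V a (V b f) := by
    intro a b f; simp only [hVd, map_add]; exact hU _ _ _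
  have hVc : ∀ f, Continuous (fun z => V z f) := fun f => (hUc f).comp hPc
  have hpi := Real.pi_pos
  have inv : ∀ θ, ∫ z, U (rotL i k hik θ z) f ∂σ = ∫ z, U z f ∂σ := by
    intro θ
    have h1 := sphM_inv ((rotL i k hik θ).toLinearIsometryEquiv rfl) t
    have h2 : ∫ z, U z f ∂(σ.map ((rotL i k hik θ).toLinearIsometryEquiv rfl)) = ∫ z, U z f ∂σ := by rw [hσ, h1]
    rw [← h2, integral_map]
    · rfl
    · exact (LinearIsometryEquiv.continuous _).aemeasurable
    · exact (hUc f).aestronglyMeasurable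
  have hrc : Continuous (fun p : ℝ × Euc d => U (rotL i k hik p.1 p.2) f) := by
    apply (hUc f).comp
    simp only [rotL_apply]
    fun_prop
  have e1 : (2 * Real.pi) • ∫ z, U z f ∂σ = ∫ z, (∫ θ in (-Real.pi)..Real.pi, U (rotL i k hik θ z) f) ∂σ := by
    rw [← intervalIntegral_integral_swap]
    · simp_rw [inv]
      rw [intervalIntegral.integral_const]; congr 1; ring
    · have hfin : IsFiniteMeasure (volume.restrict (uIoc (-Real.pi) Real.pi)) := by
        rw [uIoc_of_le (by linarith)]; infer_instance
      apply Integrable.of_bound hrc.aestronglyMeasurable (2 * ‖g‖)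
      filter_upwards with p
      rw [(U _).norm_map]; exact hfn
  have e2 : ∀ z, ‖∫ θ in (-Real.pi)..Real.pi, U (rotL i k hik θ z) f‖ = ‖∫ θ in (-Real.pi)..Real.pi, V (eI θ * plQ i k z) f‖ := by
    intro z
    simp_rw [rotL_apply, hU]
    have := (U (z - plP i k (plQ i k z))).toContinuousLinearMap.intervalIntegral_comp_comm (a := -Real.pi) (b := Real.pi) (μ := volume) (f := fun θ => V (eI θ * plQ i k z) f) (by
      apply Continuous.intervalIntegrable
      exact (hVc f).comp (by fun_prop))
    simp only [LinearIsometry.coe_toContinuousLinearMap] at this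
    rw [this, (U _).norm_map]
  set κ := Real.sqrt |h| with hκ
  have hκ0 : 0 < κ := Real.sqrt_pos.2 hhp
  set S := {z : Euc d | |z i| ≤ κ * t} with hS
  have hSm : MeasurableSet S := by apply measurableSet_le <;> fun_prop
  set D := C1 * (|h| / (κ * t))^(1/8:ℝ) * ‖g‖ with hD
  have hD0 : 0 ≤ D := by positivity
  have bd : ∀ z, ‖∫ θ in (-Real.pi)..Real.pi, U (rotL i k hik θ z) f‖ ≤ S.indicator (fun _ => 4 * Real.pi * ‖g‖) z + D := by
    intro z
    by_cases hz : z ∈ S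
    · rw [indicator_of_mem hz]
      have := intervalIntegral.norm_integral_le_of_norm_le_const (a := -Real.pi) (b := Real.pi)
        (f := fun θ => U (rotL i k hik θ z) f) (C := 2 * ‖g‖) (fun x _ => by rw [(U _).norm_map]; exact hfn)
      rw [abs_of_pos (by linarith)] at this
      linarith
    · rw [indicator_of_notMem hz, zero_add, e2]
      have hz' : κ * t < |z i| := not_le.1 hz
      have hn : |z i| ≤ ‖plQ i k z‖ := Complex.abs_re_le_norm (plQ i k z)
      have hkt : 0 < κ * t := by positivity
      have hq : plQ i k z ≠ 0 := norm_pos_iff.1 (by linarith)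
      have := hcirc V hV hVc g (h:ℂ) (plQ i k z) hq
      rw [hfw]
      refine this.trans ?_
      rw [hD]
      rw [Complex.norm_real, Real.norm_eq_abs]
      have : κ * t ≤ ‖plQ i k z‖ := by linarith
      gcongr
  have Iint : Integrable (fun z => S.indicator (fun _ => 4 * Real.pi * ‖g‖) z + D) σ :=
    ((integrable_const _).indicator hSm).add (integrable_const _)
  have e3 : 2 * Real.pi * ‖∫ z, U z f ∂σ‖ ≤ 4 * Real.pi * ‖g‖ * σ.real S + D := by
    have : 2 * Real.pi * ‖∫ z, U z f ∂σ‖ = ‖(2 * Real.pi) • ∫ z, U z f ∂σ‖ := by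
      rw [norm_smul, Real.norm_of_nonneg (by positivity)]
    rw [this, e1]
    refine (norm_integral_le_of_norm_le Iint (Eventually.of_forall bd)).trans (le_of_eq ?_)
    rw [integral_add ((integrable_const _).indicator hSm) (integrable_const _), integral_indicator hSm]
    simp [mul_comm]
  have e4 := hslab i t κ ht0 hκ0.le
  have hκh : |h| / κ = κ := by rw [hκ]; exact Real.div_sqrt
  have hκ1 : κ ≤ 1 := Real.sqrt_le_one.2 hh
  have k8 : κ^(1/8:ℝ) = |h|^(1/16:ℝ) := by
    rw [hκ, Real.sqrt_eq_rpow, ← Real.rpow_mul (abs_nonneg _)]; norm_num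
  have kle : κ ≤ κ^(1/8:ℝ) := by
    calc κ = κ^(1:ℝ) := (Real.rpow_one _).symm
      _ ≤ _ := Real.rpow_le_rpow_of_exponent_ge hκ0 hκ1 (by norm_num)
  have hDle : D ≤ C1 * ((1/t1)^(1/8:ℝ) * κ^(1/8:ℝ)) * ‖g‖ := by
    rw [hD, ← Real.mul_rpow (by positivity) hκ0.le]
    gcongr
    rw [← div_div, hκh]
    rw [div_eq_mul_one_div, mul_comm]
    gcongr
  rw [← k8]
  have e5 : 4 * Real.pi * ‖g‖ * σ.real S ≤ 4 * Real.pi * ‖g‖ * (C2 * κ^(1/8:ℝ)) := by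
    gcongr
    exact e4.trans (by gcongr)
  have e6 : ‖∫ z, U z f ∂σ‖ ≤ 2 * Real.pi * ‖∫ z, U z f ∂σ‖ := by
    have := norm_nonneg (∫ z, U z f ∂σ)
    nlinarith [Real.pi_gt_three]
  calc _ ≤ _ := e6.trans e3
    _ ≤ 4 * Real.pi * ‖g‖ * (C2 * κ^(1/8:ℝ)) + C1 * ((1/t1)^(1/8:ℝ) * κ^(1/8:ℝ)) * ‖g‖ := add_le_add e5 hDle
    _ = _ := by ring

end

section
structure BoxTree {X : Type} (box : List Bool → Set X) : Prop where
  sub : ∀ b v, box (b :: v) ⊆ box v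
  cov : ∀ v, box v ⊆ box (false :: v) ∪ box (true :: v)
  disj : ∀ v, Disjoint (box (false :: v)) (box (true :: v))

lemma desc_cases {v w : List Bool} (h : v <:+ w) : w = v ∨ ∃ b, (b :: v) <:+ w := by
  obtain ⟨t, rfl⟩ := h
  rcases List.eq_nil_or_concat t with rfl | ⟨s, b, rfl⟩
  · left; rfl
  · right; exact ⟨b, s, by simp⟩

lemma desc_unique {v w : List Bool} {b c : Bool} (h : (b :: v) <:+ w) (h' : (c :: v) <:+ w) : b = c := by
  have := List.suffix_of_suffix_length_le h h' (by simp)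
  have := this.eq_of_length (by simp)
  simpa using this

variable {X : Type} {box : List Bool → Set X}

lemma BoxTree.mono (hb : BoxTree box) {v w : List Bool} (h : v <:+ w) : box w ⊆ box v := by
  obtain ⟨t, rfl⟩ := h
  induction t with
  | nil => exact le_rfl
  | cons b t ih => exact (hb.sub b (t ++ v)).trans ih

/-- weighted sum over a set -/
def wsum (f : List Bool → ℝ≥0∞) (S : Set (List Bool)) : ℝ≥0∞ := ∑' w, S.indicator f w

lemma wsum_mono_set (f : List Bool → ℝ≥0∞) {S T : Set (List Bool)} (h : S ⊆ T) : wsum f S ≤ wsum f T :=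
  ENNReal.tsum_le_tsum fun w => indicator_le_indicator_of_subset h (fun _ => zero_le) w

lemma wsum_mono {f g : List Bool → ℝ≥0∞} {S : Set (List Bool)} (h : ∀ w ∈ S, f w ≤ g w) : wsum f S ≤ wsum g S :=
  ENNReal.tsum_le_tsum fun w => indicator_le_indicator' (h w)

lemma wsum_union_le (f : List Bool → ℝ≥0∞) (S T : Set (List Bool)) : wsum f (S ∪ T) ≤ wsum f S + wsum f T := by
  unfold wsum
  rw [← ENNReal.tsum_add]
  apply ENNReal.tsum_le_tsum
  intro w
  by_cases h1 : w ∈ S <;> by_cases h2 : w ∈ T <;> simp [h1, h2]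

lemma wsum_union_disj (f : List Bool → ℝ≥0∞) {S T : Set (List Bool)} (h : Disjoint S T) : wsum f (S ∪ T) = wsum f S + wsum f T := by
  unfold wsum
  rw [← ENNReal.tsum_add]
  congr 1; ext w
  rw [indicator_union_of_disjoint h]

lemma wsum_iUnion_le {ι : Type} (f : List Bool → ℝ≥0∞) (S : ι → Set (List Bool)) : wsum f (⋃ i, S i) ≤ ∑' i, wsum f (S i) := by
  unfold wsum
  rw [ENNReal.tsum_comm]
  apply ENNReal.tsum_le_tsum
  intro w
  by_cases h : w ∈ ⋃ i, S i
  · obtain ⟨i, hi⟩ := mem_iUnion.1 h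
    rw [indicator_of_mem h]
    refine le_trans ?_ (ENNReal.le_tsum i)
    rw [indicator_of_mem hi]
  · rw [indicator_of_notMem h]; exact zero_le

lemma wsum_singleton (f : List Bool → ℝ≥0∞) (v : List Bool) : wsum f {v} = f v := by
  unfold wsum
  rw [tsum_eq_single v]
  · simp
  · intro w hw; simp [hw]

lemma le_wsum (f : List Bool → ℝ≥0∞) {S : Set (List Bool)} {v : List Bool} (h : v ∈ S) : f v ≤ wsum f S := by
  rw [← wsum_singleton f v]; exact wsum_mono_set f (by simpa using h)

lemma wsum_le_of_levels (f : List Bool → ℝ≥0∞) (S : Set (List Bool)) (c : ℝ≥0∞)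
    (h : ∀ n, wsum f (S ∩ {w | w.length < n}) ≤ c) : wsum f S ≤ c := by
  unfold wsum
  rw [ENNReal.tsum_eq_iSup_sum]
  apply iSup_le
  intro F
  refine le_trans ?_ (h (F.sup List.length + 1))
  unfold wsum
  refine le_trans (le_of_eq ?_) (ENNReal.sum_le_tsum F)
  apply Finset.sum_congr rfl
  intro w hw
  have : w.length < F.sup List.length + 1 := Nat.lt_succ_of_le (Finset.le_sup (f := List.length) hw)
  by_cases hS : w ∈ S
  · rw [indicator_of_mem hS, indicator_of_mem]; exact ⟨hS, this⟩
  · rw [indicator_of_notMem hS, indicator_of_notMem]; exact fun h => hS h.1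

def wt (θ : ℝ≥0∞) (w : List Bool) : ℝ≥0∞ := θ ^ w.length

/-- tree content -/
def HH (box : List Bool → Set X) (θ : ℝ≥0∞) (v : List Bool) (E : Set X) : ℝ≥0∞ :=
  ⨅ (S : Set (List Bool)) (_ : ∀ w ∈ S, v <:+ w) (_ : E ∩ box v ⊆ ⋃ w ∈ S, box w), wsum (wt θ) S

variable {θ : ℝ≥0∞}

lemma HH_le {v : List Bool} {E : Set X} (S : Set (List Bool)) (h1 : ∀ w ∈ S, v <:+ w) (h2 : E ∩ box v ⊆ ⋃ w ∈ S, box w) :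
    HH box θ v E ≤ wsum (wt θ) S := iInf_le_of_le S (iInf_le_of_le h1 (iInf_le _ h2))

lemma HH_exists {v : List Bool} {E : Set X} {c : ℝ≥0∞} (h : HH box θ v E < c) :
    ∃ S : Set (List Bool), (∀ w ∈ S, v <:+ w) ∧ (E ∩ box v ⊆ ⋃ w ∈ S, box w) ∧ wsum (wt θ) S < c := by
  unfold HH at h
  simp only [iInf_lt_iff] at h
  obtain ⟨S, h1, h2, h3⟩ := h
  exact ⟨S, h1, h2, h3⟩

lemma HH_le_wt (v : List Bool) (E : Set X) : HH box θ v E ≤ wt θ v := by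
  rw [← wsum_singleton (wt θ) v]
  exact HH_le {v} (by simp) (by simp)

lemma HH_mono (v : List Bool) {E F : Set X} (h : E ⊆ F) : HH box θ v E ≤ HH box θ v F := by
  unfold HH
  refine iInf_mono fun S => iInf_mono fun h1 => ?_
  apply le_iInf; intro h2
  exact iInf_le _ ((inter_subset_inter_left _ h).trans h2)

lemma HH_empty (v : List Bool) {E : Set X} (h : E ∩ box v = ∅) : HH box θ v E = 0 := by
  refine le_antisymm ((HH_le ∅ (by simp) (by simp [h])).trans (le_of_eq ?_)) zero_le
  simp [wsum]

lemma HH_iUnion_le {ι : Type} [Countable ι] (v : List Bool) (E : ι → Set X) : HH box θ v (⋃ i, E i) ≤ ∑' i, HH box θ v (E i) := by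
  apply ENNReal.le_of_forall_pos_le_add
  intro ε hε hfin
  obtain ⟨δ, hδ, hδs⟩ := ENNReal.exists_pos_sum_of_countable' (ENNReal.coe_pos.2 hε).ne' ι
  have : ∀ i, ∃ S : Set (List Bool), (∀ w ∈ S, v <:+ w) ∧ (E i ∩ box v ⊆ ⋃ w ∈ S, box w) ∧ wsum (wt θ) S < HH box θ v (E i) + δ i := by
    intro i
    apply HH_exists
    exact ENNReal.lt_add_right (ne_top_of_le_ne_top hfin.ne (ENNReal.le_tsum i)) (hδ i).ne'
  choose S h1 h2 h3 using this
  calc HH box θ v (⋃ i, E i) ≤ wsum (wt θ) (⋃ i, S i) := by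
        apply HH_le
        · intro w hw; obtain ⟨i, hi⟩ := mem_iUnion.1 hw; exact h1 i w hi
        · rintro x ⟨hx, hxv⟩
          obtain ⟨i, hi⟩ := mem_iUnion.1 hx
          have := h2 i ⟨hi, hxv⟩
          simp only [mem_iUnion] at this ⊢
          obtain ⟨w, hw, hxw⟩ := this
          exact ⟨w, ⟨i, hw⟩, hxw⟩
    _ ≤ ∑' i, wsum (wt θ) (S i) := wsum_iUnion_le _ _
    _ ≤ ∑' i, (HH box θ v (E i) + δ i) := ENNReal.tsum_le_tsum fun i => (h3 i).le
    _ = ∑' i, HH box θ v (E i) + ∑' i, δ i := ENNReal.tsum_add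
    _ ≤ _ := by gcongr

lemma HH_desc_le {v w : List Bool} {E : Set X} (h : v <:+ w) : HH box θ v (E ∩ box w) ≤ HH box θ w E := by
  unfold HH
  refine le_iInf fun S => le_iInf fun h1 => le_iInf fun h2 => ?_
  refine HH_le S (fun u hu => h.trans (h1 u hu)) ?_
  exact inter_subset_left.trans h2

lemma HH_cover_le {v : List Bool} {E : Set X} (S : Set (List Bool)) (h1 : ∀ w ∈ S, v <:+ w) (h2 : E ∩ box v ⊆ ⋃ w ∈ S, box w) :
    HH box θ v E ≤ wsum (fun w => HH box θ w E) S := by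
  have h3 : HH box θ v E ≤ HH box θ v (⋃ w : S, E ∩ box w) := by
    have : HH box θ v E = HH box θ v (E ∩ box v) := by
      unfold HH; simp [inter_assoc]
    rw [this]
    apply HH_mono
    intro x hx
    have := h2 hx
    simp only [mem_iUnion] at this ⊢
    obtain ⟨w, hw, hxw⟩ := this
    exact ⟨⟨w, hw⟩, hx.1, hxw⟩
  refine h3.trans ((HH_iUnion_le v _).trans ?_)
  unfold wsum
  rw [← tsum_subtype]
  exact ENNReal.tsum_le_tsum fun w => HH_desc_le (h1 w w.2)

lemma HH_children_le (hb : BoxTree box) (v : List Bool) (E : Set X) :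
    HH box θ v E ≤ HH box θ (false :: v) E + HH box θ (true :: v) E := by
  have h := HH_cover_le (θ := θ) (v := v) (E := E) (box := box) {false :: v, true :: v} (by
    rintro w (rfl | rfl) <;> exact List.suffix_cons _ _) (by
    rintro x ⟨-, hx⟩
    rcases hb.cov v hx with h | h
    · simp [h]
    · simp [h])
  refine h.trans (le_of_eq ?_)
  rw [insert_eq, wsum_union_disj, wsum_singleton, wsum_singleton]
  simp

lemma HH_children_eq (hb : BoxTree box) (v : List Bool) (E : Set X) (h : HH box θ v E < wt θ v) :
    HH box θ (false :: v) E + HH box θ (true :: v) E ≤ HH box θ v E := by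
  apply le_of_forall_gt
  intro c hc
  obtain ⟨S, h1, h2, h3⟩ := HH_exists (lt_min hc h)
  have hv : v ∉ S := fun hv => absurd ((le_wsum (wt θ) hv).trans_lt h3) (not_lt.2 (min_le_right _ _))
  set T : Bool → Set (List Bool) := fun b => {w ∈ S | (b :: v) <:+ w} with hT
  have hcov : ∀ b, HH box θ (b :: v) E ≤ wsum (wt θ) (T b) := by
    intro b
    apply HH_le
    · intro w hw; exact hw.2
    · rintro x ⟨hx, hxb⟩
      have := h2 ⟨hx, hb.sub b v hxb⟩
      simp only [mem_iUnion] at this ⊢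
      obtain ⟨w, hw, hxw⟩ := this
      refine ⟨w, ⟨hw, ?_⟩, hxw⟩
      rcases desc_cases (h1 w hw) with rfl | ⟨c, hcw⟩
      · exact absurd hw hv
      · by_cases hbc : c = b
        · subst hbc; exact hcw
        · exfalso
          have hxc := hb.mono hcw hxw
          have hd := hb.disj v
          rw [Set.disjoint_left] at hd
          cases b <;> cases c <;> simp_all
  have hdis : Disjoint (T false) (T true) := by
    rw [Set.disjoint_left]
    rintro w ⟨-, ha⟩ ⟨-, hb⟩
    exact absurd (desc_unique ha hb) (by simp)
  calc _ ≤ wsum (wt θ) (T false) + wsum (wt θ) (T true) := add_le_add (hcov _) (hcov _)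
    _ = wsum (wt θ) (T false ∪ T true) := (wsum_union_disj _ hdis).symm
    _ ≤ wsum (wt θ) S := wsum_mono_set _ (by rintro w (hw | hw) <;> exact hw.1)
    _ < c := lt_of_lt_of_le h3 (min_le_left _ _)

end

section
variable {X : Type} {box : List Bool → Set X} {θ : ℝ≥0∞}

lemma wt_ne_top (hθ1 : θ ≤ 1) (v : List Bool) : wt θ v ≠ ⊤ :=
  ne_top_of_le_ne_top ENNReal.one_ne_top (pow_le_one' hθ1 _)

lemma HH_incr_q (hb : BoxTree box) (hθ0 : θ ≠ 0) (hθ1 : θ ≤ 1) (E : ℕ → Set X) (hE : Monotone E) (q : ℝ≥0∞) (hq : q < 1) :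
    q * HH box θ [] (⋃ n, E n) ≤ ⨆ n, HH box θ [] (E n) := by
  set h : List Bool → ℝ≥0∞ := fun v => ⨆ n, HH box θ v (E n) with hh
  have hqt : q ≠ ⊤ := (hq.trans ENNReal.one_lt_top).ne
  set Sat : Set (List Bool) := {v | q * wt θ v < h v} with hSat
  have hadd : ∀ v, v ∉ Sat → h (false :: v) + h (true :: v) ≤ h v := by
    intro v hv
    have h1 : h v ≤ q * wt θ v := not_lt.1 hv
    have hw0 : wt θ v ≠ 0 := pow_ne_zero _ hθ0
    have h2 : q * wt θ v < wt θ v := by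
      calc q * wt θ v < 1 * wt θ v := by
            rw [ENNReal.mul_lt_mul_iff_left hw0 (wt_ne_top hθ1 v)]; exact hq
        _ = _ := one_mul _
    simp only [hh]
    rw [ENNReal.iSup_add_iSup_of_monotone (fun a b hab => HH_mono _ (hE hab)) (fun a b hab => HH_mono _ (hE hab))]
    apply iSup_mono
    intro n
    apply HH_children_eq hb
    exact lt_of_le_of_lt ((le_iSup (fun n => HH box θ v (E n)) n).trans h1) h2
  set M : List Bool → Set (List Bool) := fun v => {w | v <:+ w ∧ w ∈ Sat ∧ ∀ u, v <:+ u → u <:+ w → u ≠ w → u ∉ Sat} with hM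
  have hMn : ∀ n v, q * wsum (wt θ) (M v ∩ {w | w.length < v.length + n}) ≤ h v := by
    intro n
    induction n with
    | zero =>
      intro v
      have : M v ∩ {w | w.length < v.length + 0} = ∅ := by
        ext w; simp only [hM, mem_inter_iff, mem_setOf_eq, mem_empty_iff_false, iff_false]
        rintro ⟨⟨h1, -⟩, h2⟩
        have := h1.length_le; omega
      rw [this]; simp [wsum]
    | succ n ih =>
      intro v
      by_cases hv : v ∈ Sat
      · have : M v ∩ {w | w.length < v.length + (n+1)} ⊆ {v} := by
          rintro w ⟨⟨h1, h2, h3⟩, -⟩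
          by_contra hne
          exact h3 v (List.suffix_refl v) h1 (fun e => hne e.symm) hv
        calc _ ≤ q * wt θ v := by
              gcongr
              rw [← wsum_singleton (wt θ) v]; exact wsum_mono_set _ this
          _ ≤ h v := le_of_lt hv
      · have : M v ∩ {w | w.length < v.length + (n+1)} ⊆ (M (false :: v) ∩ {w | w.length < (false :: v).length + n}) ∪ (M (true :: v) ∩ {w | w.length < (true :: v).length + n}) := by
          rintro w ⟨⟨h1, h2, h3⟩, h4⟩
          rcases desc_cases h1 with rfl | ⟨b, hbw⟩
          · exact absurd h2 hv
          · have : w ∈ M (b :: v) ∩ {w | w.length < (b :: v).length + n} := by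
              refine ⟨⟨hbw, h2, fun u hu1 hu2 hu3 => h3 u ((List.suffix_cons b v).trans hu1) hu2 hu3⟩, ?_⟩
              simp only [mem_setOf_eq, List.length_cons] at h4 ⊢; omega
            cases b
            · left; exact this
            · right; exact this
        calc _ ≤ q * (wsum (wt θ) (M (false :: v) ∩ {w | w.length < (false :: v).length + n}) + wsum (wt θ) (M (true :: v) ∩ {w | w.length < (true :: v).length + n})) := by
              gcongr
              exact (wsum_mono_set _ this).trans (wsum_union_le _ _ _)
          _ ≤ h (false :: v) + h (true :: v) := by
              rw [mul_add]; exact add_le_add (ih _) (ih _)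
          _ ≤ h v := hadd v hv
  have hMt : q * wsum (wt θ) (M []) ≤ h [] := by
    by_cases hq0 : q = 0
    · rw [hq0, zero_mul]; exact zero_le
    rw [mul_comm, ← ENNReal.le_div_iff_mul_le (Or.inl hq0) (Or.inl hqt)]
    apply wsum_le_of_levels
    intro n
    rw [ENNReal.le_div_iff_mul_le (Or.inl hq0) (Or.inl hqt), mul_comm]
    have := hMn n []
    simpa using this
  set N : Set X := {x | ∀ w ∈ M [], x ∉ box w} with hN
  have hNs : ∀ w x, x ∈ box w → x ∈ N → w ∉ Sat := by
    intro w
    induction hl : w.length using Nat.strong_induction_on generalizing w with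
    | _ n ih =>
      intro x hxw hxN hw
      by_cases hm : ∃ u, u <:+ w ∧ u ≠ w ∧ u ∈ Sat
      · obtain ⟨u, hu1, hu2, hu3⟩ := hm
        have hlt : u.length < n := by
          rw [← hl]
          refine lt_of_le_of_ne hu1.length_le fun e => hu2 (hu1.eq_of_length e)
        exact ih _ hlt u rfl x (hb.mono hu1 hxw) hxN hu3
      · push Not at hm
        exact hxN w ⟨List.nil_suffix, hw, fun u _ h2 h3 => hm u h2 h3⟩ hxw
  have hNz : ∀ n, HH box θ [] (N ∩ E n) = 0 := by
    intro n
    apply le_antisymm _ zero_le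
    have hfin : HH box θ [] (E n) ≠ ⊤ := ne_top_of_le_ne_top (wt_ne_top hθ1 []) (HH_le_wt _ _)
    have key : ∀ ε : ℝ≥0∞, ε ≠ 0 → (1 - q) * HH box θ [] (N ∩ E n) ≤ ε := by
      intro ε hε
      obtain ⟨S, h1, h2, h3⟩ := HH_exists (box := box) (θ := θ) (v := []) (E := E n) (c := HH box θ [] (E n) + ε) (ENNReal.lt_add_right hfin hε)
      set S' := {w ∈ S | (box w ∩ N).Nonempty} with hS'
      have hSu : (S \ S') ∪ S' = S := diff_union_of_subset (fun w hw => hw.1)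
      have hdj : Disjoint (S \ S') S' := disjoint_sdiff_left
      have hc : wsum (wt θ) S = wsum (wt θ) (S \ S') + wsum (wt θ) S' := by
        rw [← wsum_union_disj _ hdj, hSu]
      have hfinS : wsum (wt θ) S ≠ ⊤ ∨ ε = ⊤ := by
        by_cases he : ε = ⊤
        · right; exact he
        · left; exact (h3.trans_le le_top).ne
      rcases hfinS with hfinS | he
      swap
      · rw [he]; exact le_top
      have hA : wsum (wt θ) (S \ S') ≠ ⊤ := ne_top_of_le_ne_top hfinS (wsum_mono_set _ diff_subset)
      have hB : wsum (wt θ) S' ≠ ⊤ := ne_top_of_le_ne_top hfinS (wsum_mono_set _ (fun w hw => hw.1))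
      have h4 : HH box θ [] (E n) ≤ wsum (wt θ) (S \ S') + q * wsum (wt θ) S' := by
        refine (HH_cover_le S h1 h2).trans ?_
        rw [← hSu, wsum_union_disj _ hdj, hSu]
        gcongr
        · exact wsum_mono fun w _ => HH_le_wt _ _
        · have : q * wsum (wt θ) S' = wsum (fun w => q * wt θ w) S' := by
            unfold wsum
            rw [← ENNReal.tsum_mul_left]
            congr 1; ext w
            by_cases hw : w ∈ S' <;> simp [hw]
          rw [this]
          apply wsum_mono
          rintro w ⟨hw, x, hx1, hx2⟩
          exact (le_iSup (fun n => HH box θ w (E n)) n).trans (not_lt.1 (hNs w x hx1 hx2))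
      have h5 : wsum (wt θ) S' ≤ q * wsum (wt θ) S' + ε := by
        have h6 : wsum (wt θ) (S \ S') + wsum (wt θ) S' ≤ wsum (wt θ) (S \ S') + (q * wsum (wt θ) S' + ε) := by
          rw [← hc, ← add_assoc]
          exact h3.le.trans (by gcongr)
        exact (ENNReal.add_le_add_iff_left hA).1 h6
      have h7 : HH box θ [] (N ∩ E n) ≤ wsum (wt θ) S' := by
        apply HH_le
        · intro w _; exact List.nil_suffix
        · rintro x ⟨⟨hxN, hxE⟩, hx0⟩
          have := h2 ⟨hxE, hx0⟩
          simp only [mem_iUnion] at this ⊢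
          obtain ⟨w, hw, hxw⟩ := this
          exact ⟨w, ⟨hw, x, hxw, hxN⟩, hxw⟩
      calc (1 - q) * HH box θ [] (N ∩ E n) ≤ (1 - q) * wsum (wt θ) S' := by gcongr
        _ = wsum (wt θ) S' - q * wsum (wt θ) S' := by rw [ENNReal.sub_mul (fun _ _ => hB), one_mul]
        _ ≤ ε := by rw [tsub_le_iff_left]; exact h5
    have h0 : (1 - q) * HH box θ [] (N ∩ E n) = 0 := by
      by_contra hne
      obtain ⟨c, hc0, hc⟩ := exists_between (pos_iff_ne_zero.2 hne)
      exact absurd (key c hc0.ne') (not_le.2 hc)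
    rcases mul_eq_zero.1 h0 with h | h
    · exact absurd (tsub_eq_zero_iff_le.1 h) (not_le.2 hq)
    · exact h.le
  have hfinal : HH box θ [] (⋃ n, E n) ≤ wsum (wt θ) (M []) := by
    have h1 : (⋃ n, E n) ⊆ ⋃ o : Option ℕ, (match o with | none => ⋃ w ∈ M [], box w | some n => N ∩ E n) := by
      intro x hx
      obtain ⟨n, hn⟩ := mem_iUnion.1 hx
      by_cases hxN : x ∈ N
      · exact mem_iUnion.2 ⟨some n, hxN, hn⟩
      · refine mem_iUnion.2 ⟨none, ?_⟩
        simp only [hN, mem_setOf_eq, not_forall, not_not] at hxN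
        obtain ⟨w, hw, hxw⟩ := hxN
        exact mem_iUnion₂.2 ⟨w, hw, hxw⟩
    refine (HH_mono [] h1).trans ((HH_iUnion_le [] _).trans ?_)
    rw [tsum_eq_single none]
    · apply HH_le
      · intro w _; exact List.nil_suffix
      · exact inter_subset_left
    · rintro (_ | n) hn
      · exact absurd rfl hn
      · exact hNz n
  exact (mul_le_mul_right hfinal q).trans hMt

lemma HH_incr (hb : BoxTree box) (hθ0 : θ ≠ 0) (hθ1 : θ ≤ 1) (E : ℕ → Set X) (hE : Monotone E) :
    HH box θ [] (⋃ n, E n) ≤ ⨆ n, HH box θ [] (E n) := by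
  apply le_of_forall_lt
  intro c hc
  have hfin : HH box θ [] (⋃ n, E n) ≠ ⊤ := ne_top_of_le_ne_top (wt_ne_top hθ1 []) (HH_le_wt _ _)
  obtain ⟨c', hc1, hc2⟩ := exists_between hc
  set Hc := HH box θ [] (⋃ n, E n) with hHc
  have h0 : Hc ≠ 0 := (zero_le.trans_lt hc).ne'
  have := HH_incr_q hb hθ0 hθ1 E hE (c' / Hc) (by
    rw [ENNReal.div_lt_iff (Or.inl h0) (Or.inl hfin), one_mul]; exact hc2)
  rw [← hHc, ENNReal.div_mul_cancel h0 hfin] at this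
  exact hc1.trans_le this

end

section
variable {X : Type} {box : List Bool → Set X} {θ : ℝ≥0∞}

/-- truncations of a Souslin set -/
def trS (f : (ℕ → ℕ) → X) (k : ℕ) (n : ℕ → ℕ) : Set X := f '' {a | ∀ i < k, a i ≤ n i}

lemma souslin_choose (hb : BoxTree box) (hθ0 : θ ≠ 0) (hθ1 : θ ≤ 1) (f : (ℕ → ℕ) → X) (L : ℝ≥0∞)
    (hL : L < HH box θ [] (range f)) : ∃ n : ℕ → ℕ, ∀ k, L < HH box θ [] (trS f k n) := by
  have step : ∀ k (s : ℕ → ℕ), L < HH box θ [] (trS f k s) → ∃ m, L < HH box θ [] (trS f (k+1) (Function.update s k m)) := by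
    intro k s hs
    have hmono : Monotone (fun m => trS f (k+1) (Function.update s k m)) := by
      intro m m' hm
      apply image_mono
      intro a ha i hi
      have := ha i hi
      by_cases hik : i = k
      · subst hik; simp only [Function.update_self] at this ⊢; omega
      · rw [Function.update_of_ne hik] at this ⊢; exact this
    have hU : trS f k s ⊆ ⋃ m, trS f (k+1) (Function.update s k m) := by
      rintro _ ⟨a, ha, rfl⟩
      refine mem_iUnion.2 ⟨a k, a, ?_, rfl⟩
      intro i hi
      by_cases hik : i = k
      · subst hik; simp
      · rw [Function.update_of_ne hik]; exact ha i (by omega)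
    have := hs.trans_le ((HH_mono [] hU).trans (HH_incr hb hθ0 hθ1 _ hmono))
    exact lt_iSup_iff.1 this
  choose! m hm using step
  let P : ℕ → (ℕ → ℕ) := fun k => Nat.rec (fun _ => 0) (fun k s => Function.update s k (m k s)) k
  have hPs : ∀ k, P (k+1) = Function.update (P k) k (m k (P k)) := fun k => rfl
  have hP : ∀ k, L < HH box θ [] (trS f k (P k)) := by
    intro k
    induction k with
    | zero =>
      have : trS f 0 (P 0) = range f := by simp [trS]
      rw [this]; exact hL
    | succ k ih => rw [hPs]; exact hm k _ ih
  refine ⟨fun i => P (i+1) i, ?_⟩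
  have hst : ∀ k i, i < k → P k i = P (i+1) i := by
    intro k
    induction k with
    | zero => intro i hi; omega
    | succ k ih =>
      intro i hi
      by_cases hik : i = k
      · subst hik; rfl
      · rw [hPs, Function.update_of_ne hik]; exact ih i (by omega)
  intro k
  have : trS f k (fun i => P (i+1) i) = trS f k (P k) := by
    unfold trS
    congr 1; ext a
    exact forall₂_congr fun i hi => by rw [hst k i hi]
  rw [this]; exact hP k

/-- the tree measure -/
def trM (c : List Bool → ℝ) : List Bool → ℝ
  | [] => c []
  | false :: v => min (trM c v) (c (false :: v))
  | true :: v => trM c v - min (trM c v) (c (false :: v))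

lemma trM_add (c : List Bool → ℝ) (v : List Bool) : trM c (false :: v) + trM c (true :: v) = trM c v := by
  simp [trM]

lemma trM_bd (c : List Bool → ℝ) (h0 : ∀ v, 0 ≤ c v) (hc : ∀ v, c v ≤ c (false :: v) + c (true :: v)) (v : List Bool) :
    0 ≤ trM c v ∧ trM c v ≤ c v := by
  induction v with
  | nil => exact ⟨h0 _, le_rfl⟩
  | cons b v ih =>
    cases b
    · simp only [trM]
      exact ⟨le_min ih.1 (h0 _), min_le_right _ _⟩
    · simp only [trM]
      have := hc v
      have := h0 (true :: v)
      rcases le_total (trM c v) (c (false :: v)) with h | h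
      · rw [min_eq_left h]; constructor <;> linarith [ih.1, ih.2]
      · rw [min_eq_right h]; constructor <;> linarith [ih.1, ih.2]

lemma frostman (hb : BoxTree box) (hθ1 : θ ≤ 1) (A : Set X) : ∃ μ : List Bool → ℝ,
    (∀ v, 0 ≤ μ v) ∧ (∀ v, μ v ≤ θ.toReal ^ v.length) ∧ (∀ v, μ (false :: v) + μ (true :: v) = μ v) ∧
    μ [] = (HH box θ [] A).toReal ∧ (∀ v, 0 < μ v → (A ∩ box v).Nonempty) := by
  have hfin : ∀ v, HH box θ v A ≠ ⊤ := fun v => ne_top_of_le_ne_top (wt_ne_top hθ1 v) (HH_le_wt _ _)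
  set c : List Bool → ℝ := fun v => (HH box θ v A).toReal with hc
  have hbd := trM_bd c (fun v => ENNReal.toReal_nonneg) (fun v => by
    simp only [hc]
    rw [← ENNReal.toReal_add (hfin _) (hfin _)]
    exact ENNReal.toReal_mono (ENNReal.add_ne_top.2 ⟨hfin _, hfin _⟩) (HH_children_le hb v A))
  refine ⟨trM c, fun v => (hbd v).1, fun v => ?_, trM_add c, rfl, fun v hv => ?_⟩
  · refine (hbd v).2.trans ?_
    have := ENNReal.toReal_mono (wt_ne_top hθ1 v) (HH_le_wt (box := box) v A)
    simpa [wt] using this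
  · by_contra hne
    rw [Set.not_nonempty_iff_eq_empty] at hne
    have h1 := (hbd v).2
    simp only [hc, HH_empty v hne, ENNReal.toReal_zero] at h1
    linarith

end

section
variable {d : ℕ}

/-- number of splittings of coordinate `c` before level `p` -/
def ex (d : ℕ) : ℕ → Fin d → ℕ
  | 0, _ => 0
  | p + 1, c => if p % d = c then ex d p c + 1 else ex d p c

lemma ex_eq (p : ℕ) (c : Fin d) : ex d p c = (p + d - 1 - c) / d := by
  have hc := c.2
  have hd : 0 < d := by omega
  induction p with
  | zero => simp only [ex]; rw [Nat.div_eq_of_lt]; omega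
  | succ p ih =>
    simp only [ex]
    have e : p + 1 + d - 1 - c = (p + d - 1 - c) + 1 := by omega
    rw [e, Nat.succ_div, ih]
    have hiff : d ∣ p + d - 1 - c + 1 ↔ p % d = c := by
      have e2 : p + d - 1 - c + 1 = p + (d - c) := by omega
      rw [e2]
      constructor
      · rintro ⟨k, hk⟩
        have hk0 : k ≠ 0 := by rintro rfl; omega
        obtain ⟨j, rfl⟩ : ∃ j, k = j + 1 := ⟨k - 1, by omega⟩
        have : p = d * j + c := by
          have : d * (j+1) = d * j + d := by ring
          omega
        rw [this, Nat.mul_add_mod, Nat.mod_eq_of_lt hc]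
      · intro h
        have := Nat.div_add_mod p d
        exact ⟨p / d + 1, by rw [mul_add]; omega⟩
    split_ifs with h1 h2 h2 <;> first | rfl | (exfalso; tauto)

lemma ex_ge (p : ℕ) (c : Fin d) : p / d ≤ ex d p c := by
  rw [ex_eq]; exact Nat.div_le_div_right (by have := c.2; omega)

lemma ex_mul (n : ℕ) (c : Fin d) : ex d (d * n) c = n := by
  have hc := c.2
  rw [ex_eq]
  have : d * n + d - 1 - c = d * n + (d - 1 - c) := by omega
  rw [this, Nat.mul_add_div (by omega), Nat.div_eq_of_lt (by omega), add_zero]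

lemma ex_sum (hd : 0 < d) (p : ℕ) : ∑ c, ex d p c = p := by
  induction p with
  | zero => simp [ex]
  | succ p ih =>
    have : ∀ c : Fin d, ex d (p+1) c = ex d p c + if c = ⟨p % d, Nat.mod_lt _ hd⟩ then 1 else 0 := by
      intro c
      have : (c = ⟨p % d, Nat.mod_lt _ hd⟩) ↔ p % d = c := by rw [Fin.ext_iff]; exact eq_comm
      simp only [ex]; split_ifs <;> first | rfl | (exfalso; tauto)
    simp_rw [this, Finset.sum_add_distrib, ih]; simp

/-- index of a box -/
def bidx (d : ℕ) : List Bool → Fin d → ℤ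
  | [], _ => 0
  | b :: v, c => if v.length % d = c then 2 * bidx d v c + (if b then 1 else 0) else bidx d v c

def bx (d : ℕ) (v : List Bool) : Set (Euc d) := {x | ∀ c, ⌊(2:ℝ)^(ex d v.length c) * x c⌋ = bidx d v c}

lemma floor_two_mul (y : ℝ) : ⌊2 * y⌋ = 2 * ⌊y⌋ ∨ ⌊2 * y⌋ = 2 * ⌊y⌋ + 1 := by
  have h1 := Int.floor_le y
  have h2 := Int.lt_floor_add_one y
  have h3 : 2 * ⌊y⌋ ≤ ⌊2 * y⌋ := by rw [Int.le_floor]; push_cast; linarith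
  have h4 : ⌊2 * y⌋ < 2 * ⌊y⌋ + 2 := by rw [Int.floor_lt]; push_cast; linarith
  omega

lemma mem_bx_cons (b : Bool) (v : List Bool) (x : Euc d) : x ∈ bx d (b :: v) ↔
    x ∈ bx d v ∧ ∀ c : Fin d, v.length % d = c → ⌊2 * ((2:ℝ)^(ex d v.length c) * x c)⌋ = 2 * bidx d v c + (if b then 1 else 0) := by
  have key : ∀ c : Fin d, v.length % d = c → (2:ℝ)^(ex d (b :: v).length c) * x c = 2 * ((2:ℝ)^(ex d v.length c) * x c) := by
    intro c hc
    simp only [List.length_cons, ex, hc, if_true, pow_succ]; ring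
  have key2 : ∀ c : Fin d, ¬ v.length % d = c → (2:ℝ)^(ex d (b :: v).length c) * x c = ((2:ℝ)^(ex d v.length c) * x c) := by
    intro c hc
    simp only [List.length_cons, ex, hc, if_false]
  constructor
  · intro h
    refine ⟨fun c => ?_, fun c hc => ?_⟩
    · have h1 := h c
      by_cases hc : v.length % d = c
      · rw [key c hc] at h1
        simp only [bidx, hc, if_true] at h1
        have := floor_two_mul ((2:ℝ)^(ex d v.length c) * x c)
        cases b <;> simp at h1 <;> omega
      · rw [key2 c hc] at h1
        simpa only [bidx, hc, if_false] using h1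
    · have h1 := h c
      rw [key c hc] at h1
      simpa only [bidx, hc, if_true] using h1
  · rintro ⟨h1, h2⟩ c
    by_cases hc : v.length % d = c
    · rw [key c hc, h2 c hc]; simp [bidx, hc]
    · rw [key2 c hc, h1 c]; simp [bidx, hc]

lemma bx_tree (hd : 0 < d) : BoxTree (bx d) where
  sub b v x hx := ((mem_bx_cons b v x).1 hx).1
  cov v x hx := by
    have h := floor_two_mul ((2:ℝ)^(ex d v.length ⟨v.length % d, Nat.mod_lt _ hd⟩) * x ⟨v.length % d, Nat.mod_lt _ hd⟩)
    rw [hx ⟨v.length % d, Nat.mod_lt _ hd⟩] at h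
    rcases h with h | h
    · left
      rw [mem_bx_cons]
      refine ⟨hx, fun c hc => ?_⟩
      have : c = ⟨v.length % d, Nat.mod_lt _ hd⟩ := Fin.ext hc.symm
      subst this; simpa using h
    · right
      rw [mem_bx_cons]
      refine ⟨hx, fun c hc => ?_⟩
      have : c = ⟨v.length % d, Nat.mod_lt _ hd⟩ := Fin.ext hc.symm
      subst this; simpa using h
  disj v := by
    rw [Set.disjoint_left]
    intro x h1 h2
    have a := ((mem_bx_cons _ v x).1 h1).2 ⟨v.length % d, Nat.mod_lt _ hd⟩ rfl
    have b := ((mem_bx_cons _ v x).1 h2).2 ⟨v.length % d, Nat.mod_lt _ hd⟩ rfl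
    simp at a b; omega

lemma bx_nil : bx d [] = {x | ∀ c, 0 ≤ x c ∧ x c < 1} := by
  ext x
  simp only [bx, bidx, ex, List.length_nil, pow_zero, one_mul, Int.floor_eq_zero_iff]
  rfl

lemma bx_eq_pre (v : List Bool) : bx d v = (@WithLp.ofLp 2 (Fin d → ℝ)) ⁻¹'
    (Set.pi univ (fun c => Ico ((bidx d v c : ℝ) / 2^(ex d v.length c)) (((bidx d v c : ℝ) + 1) / 2^(ex d v.length c)))) := by
  ext x
  simp only [bx, mem_preimage, Set.mem_pi, mem_univ, true_imp_iff, mem_Ico]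
  apply forall_congr'
  intro c
  have : (0:ℝ) < 2^(ex d v.length c) := by positivity
  rw [Int.floor_eq_iff, div_le_iff₀' this, lt_div_iff₀' this]

lemma bx_meas (v : List Bool) : MeasurableSet (bx d v) := by
  rw [bx_eq_pre]
  apply (PiLp.volume_preserving_ofLp (Fin d)).measurable
  exact MeasurableSet.univ_pi fun c => measurableSet_Ico

lemma bx_vol (hd : 0 < d) (v : List Bool) : volume (bx d v) = ENNReal.ofReal ((1/2)^v.length) := by
  rw [bx_eq_pre, (PiLp.volume_preserving_ofLp (Fin d)).measure_preimage
    (MeasurableSet.univ_pi fun c => measurableSet_Ico).nullMeasurableSet, volume_pi_pi]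
  simp_rw [Real.volume_Ico]
  rw [← ENNReal.ofReal_prod_of_nonneg]
  · congr 1
    have : ∀ c : Fin d, ((bidx d v c : ℝ) + 1) / 2^(ex d v.length c) - (bidx d v c : ℝ) / 2^(ex d v.length c) = (1/2)^(ex d v.length c) := by
      intro c; rw [← sub_div, add_sub_cancel_left, one_div_pow]
    simp_rw [this]
    rw [Finset.prod_pow_eq_pow_sum, ex_sum hd]
  · intro c _
    rw [← sub_div, add_sub_cancel_left]; positivity

/-- shift length at level `p` -/
def shL (d p : ℕ) (hd : 0 < d) : ℝ := (1/2)^(ex d (p+1) ⟨p % d, Nat.mod_lt _ hd⟩)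

lemma bx_shift (hd : 0 < d) (v : List Bool) (x : Euc d) :
    x ∈ bx d (true :: v) ↔ x + (-shL d v.length hd) • EuclideanSpace.single (⟨v.length % d, Nat.mod_lt _ hd⟩ : Fin d) (1:ℝ) ∈ bx d (false :: v) := by
  unfold bx
  apply forall_congr'
  intro c
  by_cases hc : v.length % d = c
  · have hc' : c = ⟨v.length % d, Nat.mod_lt _ hd⟩ := Fin.ext hc.symm
    have h1 : (2:ℝ)^(ex d (false :: v).length c) * (x + (-shL d v.length hd) • EuclideanSpace.single (⟨v.length % d, Nat.mod_lt _ hd⟩ : Fin d) (1:ℝ)) c = (2:ℝ)^(ex d (true :: v).length c) * x c - 1 := by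
      rw [hc']
      simp only [PiLp.add_apply, PiLp.smul_apply, smul_eq_mul, shL, List.length_cons, PiLp.single_apply, if_true]
      rw [mul_add, one_div_pow]; field_simp; ring
    rw [h1, Int.floor_sub_one]
    simp only [bidx, hc, if_true]
    simp; omega
  · have hc' : c ≠ ⟨v.length % d, Nat.mod_lt _ hd⟩ := fun e => hc (by rw [e])
    have h1 : (x + (-shL d v.length hd) • EuclideanSpace.single (⟨v.length % d, Nat.mod_lt _ hd⟩ : Fin d) (1:ℝ)) c = x c := by
      simp [hc']
    rw [h1]
    simp only [bidx, hc, if_false, List.length_cons]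

lemma shL_pos (p : ℕ) (hd : 0 < d) : 0 < shL d p hd := by unfold shL; positivity

lemma shL_le (p : ℕ) (hd : 0 < d) : shL d p hd ≤ (1/2)^(p / d + 1) := by
  unfold shL
  apply pow_le_pow_of_le_one (by norm_num) (by norm_num)
  simp only [ex, if_true]
  have := ex_ge p (⟨p % d, Nat.mod_lt _ hd⟩ : Fin d)
  omega

lemma bx_dist (v : List Bool) (x y : Euc d) (hx : x ∈ bx d v) (hy : y ∈ bx d v) : dist x y ≤ d * (1/2)^(v.length / d) := by
  have h1 : ∀ c, |x c - y c| ≤ (1/2)^(v.length / d) := by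
    intro c
    have h2 : |(2:ℝ)^(ex d v.length c) * x c - (2:ℝ)^(ex d v.length c) * y c| < 1 :=
      Int.abs_sub_lt_one_of_floor_eq_floor ((hx c).trans (hy c).symm)
    rw [← mul_sub, abs_mul, abs_of_pos (by positivity)] at h2
    have h3 : |x c - y c| ≤ (1/2)^(ex d v.length c) := by
      rw [one_div_pow, le_div_iff₀' (by positivity)]; exact h2.le
    exact h3.trans (pow_le_pow_of_le_one (by norm_num) (by norm_num) (ex_ge _ _))
  rw [EuclideanSpace.dist_eq]
  calc Real.sqrt (∑ i, dist (x i) (y i)^2) ≤ ∑ i, dist (x i) (y i) := by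
        apply Real.sqrt_le_iff.2 ⟨Finset.sum_nonneg fun i _ => dist_nonneg, ?_⟩
        exact Finset.sum_sq_le_sq_sum_of_nonneg fun i _ => dist_nonneg
    _ ≤ ∑ i : Fin d, (1/2)^(v.length / d) := Finset.sum_le_sum fun i _ => h1 i
    _ = _ := by simp

end

section
variable {d : ℕ}

/-- the words of length `p` -/
def lv : ℕ → Finset (List Bool)
  | 0 => {[]}
  | p + 1 => (lv p).image (List.cons false) ∪ (lv p).image (List.cons true)

lemma sum_lv_succ {M : Type} [AddCommMonoid M] (f : List Bool → M) (p : ℕ) :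
    ∑ v ∈ lv (p+1), f v = ∑ v ∈ lv p, (f (false :: v) + f (true :: v)) := by
  simp only [lv]
  rw [Finset.sum_union, Finset.sum_image, Finset.sum_image, Finset.sum_add_distrib]
  · intro a _ b _ h; simpa using h
  · intro a _ b _ h; simpa using h
  · rw [Finset.disjoint_left]
    intro x h1 h2
    obtain ⟨a, _, rfl⟩ := Finset.mem_image.1 h1
    obtain ⟨b, _, h⟩ := Finset.mem_image.1 h2
    simp at h

lemma lv_length {p : ℕ} {v : List Bool} (h : v ∈ lv p) : v.length = p := by
  induction p generalizing v with
  | zero => simp [lv] at h; simp [h]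
  | succ p ih =>
    simp only [lv, Finset.mem_union, Finset.mem_image] at h
    rcases h with ⟨a, ha, rfl⟩ | ⟨a, ha, rfl⟩ <;> simp [ih ha]

abbrev LL (d : ℕ) : Type := Lp ℝ 2 (volume : Measure (Euc d))

/-- translation -/
def tr (z : Euc d) : LL d →ₗᵢ[ℝ] LL d :=
  Lp.compMeasurePreservingₗᵢ ℝ (· + z) (measurePreserving_add_right volume z)

lemma tr_add (a b : Euc d) (f : LL d) : tr (a + b) f = tr a (tr b f) := by
  have h := Lp.compMeasurePreserving_comp_apply (E := ℝ) (p := 2) f (measurePreserving_add_right volume b) (measurePreserving_add_right volume a)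
  have e : ((· + b) ∘ (· + a) : Euc d → Euc d) = (· + (a + b)) := by
    ext x; simp [add_assoc]
  simp only [e] at h
  exact h

lemma tr_zero (f : LL d) : tr 0 f = f := by
  have h1 := tr_add 0 0 f
  rw [add_zero] at h1
  exact (tr (0 : Euc d)).injective h1.symm

lemma tr_cont (f : LL d) : Continuous fun z => tr z f := by
  have h : Continuous fun z : Euc d => (⟨⟨(· + z), by fun_prop⟩, measurePreserving_add_right volume z⟩ : {g : C(Euc d, Euc d) // MeasurePreserving g volume volume}) := by
    apply Continuous.subtype_mk
    exact ContinuousMap.continuous_of_continuous_uncurry _ (by simp only [Function.uncurry_def, ContinuousMap.coe_mk]; fun_prop)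
  exact (Lp.compMeasurePreserving_continuous (volume : Measure (Euc d)) volume ℝ (p := 2) (by norm_num)).comp
    (continuous_const.prodMk h)

lemma bx_fin (hd : 0 < d) (v : List Bool) : volume (bx d v) ≠ ∞ := by
  rw [bx_vol hd]; exact ENNReal.ofReal_ne_top

lemma inner_ic {s t : Set (Euc d)} (hs : MeasurableSet s) (ht : MeasurableSet t) (hs' : volume s ≠ ∞) (ht' : volume t ≠ ∞) :
    inner ℝ (indicatorConstLp 2 hs hs' (1:ℝ)) (indicatorConstLp 2 ht ht' (1:ℝ)) = volume.real (s ∩ t) :=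
  L2.real_inner_indicatorConstLp_one_indicatorConstLp_one hs ht hs' ht'

def ind (hd : 0 < d) (v : List Bool) : LL d := indicatorConstLp 2 (bx_meas v) (bx_fin hd v) (1:ℝ)

lemma tr_ind (hd : 0 < d) (z : Euc d) (v : List Bool) : tr z (ind hd v) =
    indicatorConstLp 2 ((measurable_id.add_const z) (bx_meas v))
      (by rw [show (id : Euc d → Euc d) = fun x => x from rfl, (measurePreserving_add_right volume z).measure_preimage (bx_meas v).nullMeasurableSet]; exact bx_fin hd v) (1:ℝ) := by
  exact Lp.indicatorConstLp_compMeasurePreserving (bx_meas v) (bx_fin hd v) 1 (measurePreserving_add_right volume z)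

lemma bx_disj (hd : 0 < d) {p : ℕ} {v w : List Bool} (hv : v.length = p) (hw : w.length = p) (h : v ≠ w) : Disjoint (bx d v) (bx d w) := by
  induction p generalizing v w with
  | zero => exfalso; apply h; rw [List.length_eq_zero_iff.1 hv, List.length_eq_zero_iff.1 hw]
  | succ p ih =>
    obtain ⟨a, v, rfl⟩ := List.exists_cons_of_length_eq_add_one hv
    obtain ⟨b, w, rfl⟩ := List.exists_cons_of_length_eq_add_one hw
    by_cases hvw : v = w
    · subst hvw
      have hab : a ≠ b := fun e => h (by rw [e])
      have := (bx_tree hd).disj v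
      cases a <;> cases b <;> first | exact absurd rfl hab | exact this | exact this.symm
    · exact (ih (by simpa using hv) (by simpa using hw) hvw).mono ((bx_tree hd).sub a v) ((bx_tree hd).sub b w)

lemma inner_ind_ne (hd : 0 < d) {p : ℕ} {v w : List Bool} (hv : v.length = p) (hw : w.length = p) (h : v ≠ w) :
    inner ℝ (ind hd v) (ind hd w) = 0 := by
  unfold ind
  rw [inner_ic, (bx_disj hd hv hw h).inter_eq]; simp

lemma norm_ind_sq (hd : 0 < d) (v : List Bool) : ‖ind hd v‖^2 = (1/2)^v.length := by
  rw [← real_inner_self_eq_norm_sq]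
  unfold ind
  rw [inner_ic, inter_self, measureReal_def, bx_vol hd, ENNReal.toReal_ofReal (by positivity)]

lemma inner_ind_nil (hd : 0 < d) (v : List Bool) : inner ℝ (ind hd []) (ind hd v) = (1/2)^v.length := by
  unfold ind
  rw [inner_ic,
    inter_eq_self_of_subset_right ((bx_tree hd).mono (List.nil_suffix (l := v))), measureReal_def, bx_vol hd, ENNReal.toReal_ofReal (by positivity)]

lemma ind_children (hd : 0 < d) (v : List Bool) : ind hd v = ind hd (false :: v) + ind hd (true :: v) := by
  unfold ind
  have e : bx d v = bx d (false :: v) ∪ bx d (true :: v) :=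
    Subset.antisymm ((bx_tree hd).cov v) (union_subset ((bx_tree hd).sub _ v) ((bx_tree hd).sub _ v))
  rw [← indicatorConstLp_disjoint_union (bx_meas _) (bx_meas _) (bx_fin hd _) (bx_fin hd _) ((bx_tree hd).disj v)]
  congr 1

lemma ind_shift (hd : 0 < d) (v : List Bool) : ind hd (true :: v) =
    tr ((-shL d v.length hd) • EuclideanSpace.single (⟨v.length % d, Nat.mod_lt _ hd⟩ : Fin d) (1:ℝ)) (ind hd (false :: v)) := by
  rw [tr_ind]
  unfold ind
  congr 1
  ext x
  exact bx_shift hd v x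

lemma norm_sum_sq {H : Type} [NormedAddCommGroup H] [InnerProductSpace ℝ H] {ι : Type} (S : Finset ι) (x : ι → H)
    (h : ∀ i ∈ S, ∀ j ∈ S, i ≠ j → inner ℝ (x i) (x j) = 0) : ‖∑ i ∈ S, x i‖^2 = ∑ i ∈ S, ‖x i‖^2 := by
  rw [← real_inner_self_eq_norm_sq, sum_inner]
  apply Finset.sum_congr rfl
  intro i hi
  rw [inner_sum, Finset.sum_eq_single i, real_inner_self_eq_norm_sq]
  · intro j hj hne; exact h i hi j hj hne.symm
  · intro h; exact absurd hi h

/-- the mass distribution at level `p` -/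
def uu (hd : 0 < d) (μ : List Bool → ℝ) (p : ℕ) : LL d := ∑ v ∈ lv p, (2^p * μ v) • ind hd v

def gg (hd : 0 < d) (μ : List Bool → ℝ) (p : ℕ) : LL d := ∑ v ∈ lv p, (2^p * (μ (false :: v) - μ (true :: v))) • ind hd (false :: v)

structure IsFr (θ : ℝ) (μ : List Bool → ℝ) : Prop where
  nn : ∀ v, 0 ≤ μ v
  le : ∀ v, μ v ≤ θ ^ v.length
  add : ∀ v, μ (false :: v) + μ (true :: v) = μ v

variable {θ : ℝ} {μ : List Bool → ℝ}

lemma IsFr.sum (h : IsFr θ μ) (p : ℕ) : ∑ v ∈ lv p, μ v = μ [] := by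
  induction p with
  | zero => simp [lv]
  | succ p ih => rw [sum_lv_succ, ← ih]; exact Finset.sum_congr rfl fun v _ => h.add v

lemma IsFr.nil_le (h : IsFr θ μ) : μ [] ≤ 1 := by simpa using h.le []

lemma IsFr.sum_sq (h : IsFr θ μ) (p : ℕ) : ∑ v ∈ lv p, (μ v)^2 ≤ θ^p := by
  have hθ : 0 ≤ θ^p := by
    have := (h.nn (List.replicate p true)).trans (h.le _)
    simpa using this
  calc ∑ v ∈ lv p, (μ v)^2 ≤ ∑ v ∈ lv p, θ^p * μ v := by
        apply Finset.sum_le_sum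
        intro v hv
        rw [sq]
        apply mul_le_mul_of_nonneg_right _ (h.nn v)
        have := h.le v
        rwa [lv_length hv] at this
    _ = θ^p * μ [] := by rw [← Finset.mul_sum, h.sum]
    _ ≤ θ^p := mul_le_of_le_one_right hθ h.nil_le

lemma uu_norm (hd : 0 < d) (h : IsFr θ μ) (p : ℕ) : ‖uu hd μ p‖^2 ≤ (2*θ)^p := by
  unfold uu
  rw [norm_sum_sq]
  · have : ∀ v ∈ lv p, ‖(2^p * μ v) • ind hd v‖^2 = 2^p * (μ v)^2 := by
      intro v hv
      rw [norm_smul, mul_pow, norm_ind_sq, lv_length hv, Real.norm_eq_abs, sq_abs, one_div_pow]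
      field_simp
    rw [Finset.sum_congr rfl this, ← Finset.mul_sum, mul_pow]
    exact mul_le_mul_of_nonneg_left (h.sum_sq p) (by positivity)
  · intro i hi j hj hne
    rw [inner_smul_left, inner_smul_right, inner_ind_ne hd (lv_length hi) (lv_length hj) hne]; simp

lemma gg_norm (hd : 0 < d) (h : IsFr θ μ) (p : ℕ) : ‖gg hd μ p‖^2 ≤ (2*θ)^p := by
  unfold gg
  rw [norm_sum_sq]
  · have : ∀ v ∈ lv p, ‖(2^p * (μ (false :: v) - μ (true :: v))) • ind hd (false :: v)‖^2 ≤ 2^p * (μ v)^2 := by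
      intro v hv
      rw [norm_smul, mul_pow, norm_ind_sq, List.length_cons, lv_length hv, Real.norm_eq_abs, sq_abs, one_div_pow]
      have e : (2 ^ p * (μ (false :: v) - μ (true :: v))) ^ 2 * (1 / 2 ^ (p + 1)) = 2^p * ((μ (false :: v) - μ (true :: v)) ^ 2 / 2) := by
        field_simp; ring
      rw [e]
      apply mul_le_mul_of_nonneg_left _ (by positivity)
      have h1 := h.nn (false :: v)
      have h2 := h.nn (true :: v)
      rw [← h.add v]
      nlinarith [mul_nonneg h1 h2, sq_nonneg (μ (false :: v)), sq_nonneg (μ (true :: v))]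
    refine (Finset.sum_le_sum this).trans ?_
    rw [← Finset.mul_sum, mul_pow]
    exact mul_le_mul_of_nonneg_left (h.sum_sq p) (by positivity)
  · intro i hi j hj hne
    rw [inner_smul_left, inner_smul_right, inner_ind_ne hd (p := p+1) (by simp [lv_length hi]) (by simp [lv_length hj]) (by simpa using hne)]; simp

lemma uu_succ (hd : 0 < d) (h : IsFr θ μ) (p : ℕ) : uu hd μ (p+1) - uu hd μ p =
    gg hd μ p - tr ((-shL d p hd) • EuclideanSpace.single (⟨p % d, Nat.mod_lt _ hd⟩ : Fin d) (1:ℝ)) (gg hd μ p) := by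
  unfold uu gg
  rw [sum_lv_succ, map_sum, ← Finset.sum_sub_distrib, ← Finset.sum_sub_distrib]
  apply Finset.sum_congr rfl
  intro v hv
  have hs := ind_shift hd v
  rw [lv_length hv] at hs
  rw [map_smul, ← hs, ind_children hd v, ← h.add v, pow_succ]
  module

lemma uu_nil (hd : 0 < d) (h : IsFr θ μ) (p : ℕ) : inner ℝ (ind hd []) (uu hd μ p) = μ [] := by
  unfold uu
  rw [inner_sum, ← h.sum p]
  apply Finset.sum_congr rfl
  intro v hv
  rw [inner_smul_right, inner_ind_nil, lv_length hv, one_div_pow]; field_simp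

lemma uu_near (hd : 0 < d) (h : IsFr θ μ) (p : ℕ) : ‖uu hd μ p - ind hd []‖^2 ≤ (2*θ)^p + 1 - 2 * μ [] := by
  rw [norm_sub_sq_real, real_inner_comm, uu_nil hd h, norm_ind_sq]
  have := uu_norm hd h p
  simp; linarith

lemma overlap (hd : 0 < d) {ν : List Bool → ℝ} (hμ : IsFr θ μ) (hν : IsFr θ ν) (p : ℕ) (z : Euc d) (h : 0 < inner ℝ (tr z (uu hd μ p)) (uu hd ν p)) :
    ∃ v w, v.length = p ∧ w.length = p ∧ 0 < μ v ∧ 0 < ν w ∧ ∃ x, x + z ∈ bx d v ∧ x ∈ bx d w := by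
  by_contra hcon
  push Not at hcon
  apply h.ne'
  unfold uu
  rw [map_sum, sum_inner]
  apply Finset.sum_eq_zero
  intro v hv
  rw [inner_sum]
  apply Finset.sum_eq_zero
  intro w hw
  rw [map_smul, inner_smul_left, inner_smul_right]
  rcases (hμ.nn v).eq_or_lt with h1 | h1
  · simp [← h1]
  rcases (hν.nn w).eq_or_lt with h2 | h2
  · simp [← h2]
  have h3 := hcon v w (lv_length hv) (lv_length hw) h1 h2
  rw [tr_ind]
  unfold ind
  rw [inner_ic]
  have : ((fun x : Euc d => id x + z) ⁻¹' bx d v) ∩ bx d w = ∅ := by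
    ext x; simp only [mem_inter_iff, mem_preimage, id, mem_empty_iff_false, iff_false, not_and]; exact h3 x
  erw [this]; simp

end

section
variable {d : ℕ}

/-- spherical averaging -/
def AA (t : ℝ) (f : LL d) : LL d := ∫ z, tr z f ∂(sphM d t)

lemma AA_int (t : ℝ) (f : LL d) : Integrable (fun z => tr z f) (sphM d t) := by
  refine Integrable.of_bound (C := ‖f‖) (tr_cont f).aestronglyMeasurable ?_
  exact Eventually.of_forall fun z => by simp

lemma AA_sub (t : ℝ) (f g : LL d) : AA t (f - g) = AA t f - AA t g := by
  unfold AA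
  rw [← integral_sub (AA_int t f) (AA_int t g)]
  simp only [map_sub]

lemma AA_norm (t : ℝ) (f : LL d) : ‖AA t f‖ ≤ ‖f‖ := by
  have := norm_integral_le_of_norm_le_const (μ := sphM d t) (f := fun z => tr z f) (C := ‖f‖) (Eventually.of_forall fun z => by simp)
  simpa [AA] using this

lemma AA_inner (t : ℝ) (f g : LL d) : inner ℝ (AA t f) g = ∫ z, inner ℝ (tr z f) g ∂(sphM d t) := by
  unfold AA
  rw [real_inner_comm, ← integral_inner (AA_int t f) g]
  simp_rw [real_inner_comm]

lemma tr_adj (z : Euc d) (f g : LL d) : inner ℝ (tr z f) g = inner ℝ f (tr (-z) g) := by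
  rw [← (tr (-z)).inner_map_map, ← tr_add, neg_add_cancel, tr_zero]

lemma AA_symm (t : ℝ) (f g : LL d) : inner ℝ (AA t f) g = inner ℝ f (AA t g) := by
  rw [AA_inner, ← real_inner_comm, AA_inner]
  simp_rw [tr_adj]
  have h := sphM_inv (LinearIsometryEquiv.neg ℝ : Euc d ≃ₗᵢ[ℝ] Euc d) t
  conv_rhs => rw [← h]
  rw [integral_map]
  · apply integral_congr_ae
    refine Eventually.of_forall fun z => ?_
    simp only [LinearIsometryEquiv.coe_neg, neg_neg]
    rw [real_inner_comm, tr_adj, neg_neg]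
  · exact (LinearIsometryEquiv.continuous _).measurable.aemeasurable
  · apply Continuous.aestronglyMeasurable
    exact continuous_const.inner ((tr_cont f).comp continuous_neg)

lemma AA_pos (hd : 2 ≤ d) (t : ℝ) (ht : 0 < t) (f g : LL d) (h : 0 < inner ℝ (AA t f) g) : ∃ z : Euc d, ‖z‖ = t ∧ 0 < inner ℝ (tr z f) g := by
  by_contra hcon
  push Not at hcon
  rw [AA_inner] at h
  have : ∫ z, inner ℝ (tr z f) g ∂(sphM d t) ≤ 0 := by
    apply integral_nonpos_of_ae
    filter_upwards [sphM_ae hd t ht] with z hz using hcon z hz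
  linarith

lemma AA_one (hd : 2 ≤ d) : ∃ t0 : ℝ, 0 < t0 ∧ t0 ≤ 1 ∧ ∀ t, 0 < t → t ≤ t0 →
    3/4 ≤ inner ℝ (AA t (ind (show 0 < d by omega) [])) (ind (show 0 < d by omega) []) := by
  have hd0 : 0 < d := by omega
  have hc := tr_cont (ind hd0 [])
  obtain ⟨δ, hδ, h⟩ := Metric.continuous_iff.1 hc 0 (1/4) (by norm_num)
  refine ⟨min (δ/2) 1, by positivity, min_le_right _ _, fun t ht htt => ?_⟩
  have hn : ‖ind hd0 []‖ = 1 := by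
    have := norm_ind_sq hd0 []
    simp at this
    rcases this with h | h
    · exact h
    · have := norm_nonneg (ind hd0 []); linarith
  rw [AA_inner]
  have e : (3/4 : ℝ) = ∫ z, (3/4:ℝ) ∂(sphM d t) := by simp
  rw [e]
  apply integral_mono_ae (integrable_const _) ((AA_int t _).inner_const _)
  filter_upwards [sphM_ae hd t ht] with z hz
  have h1 := h z (by rw [dist_zero_right, hz]; have := min_le_left (δ/2) 1; linarith)
  rw [tr_zero, dist_eq_norm] at h1
  have h2 := abs_real_inner_le_norm (tr z (ind hd0 []) - ind hd0 []) (ind hd0 [])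
  rw [inner_sub_left, hn, real_inner_self_eq_norm_sq, hn] at h2
  have := (abs_le.1 h2).1
  linarith

lemma shL_rpow (hd : 0 < d) (p : ℕ) : (shL d p hd)^(1/16:ℝ) ≤ (((1/2:ℝ)^(1/(32*d):ℝ)))^(2*p) := by
  calc (shL d p hd)^(1/16:ℝ) ≤ ((1/2:ℝ)^(p / d + 1))^(1/16:ℝ) :=
        Real.rpow_le_rpow (shL_pos p hd).le (shL_le p hd) (by norm_num)
    _ = (1/2:ℝ)^(((p/d + 1 : ℕ):ℝ) * (1/16)) := by
        rw [← Real.rpow_natCast, ← Real.rpow_mul (by norm_num)]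
    _ ≤ (1/2:ℝ)^((1/(32*d):ℝ) * ((2*p:ℕ):ℝ)) := by
        apply Real.rpow_le_rpow_of_exponent_ge (by norm_num) (by norm_num)
        have h1 : (p:ℝ)/d ≤ ((p/d+1:ℕ):ℝ) := by
          rw [div_le_iff₀ (by exact_mod_cast hd)]
          have := Nat.lt_div_mul_add (a := p) hd
          have h2 : p ≤ (p/d+1)*d := by rw [add_mul, one_mul]; omega
          exact_mod_cast h2
        push_cast at h1 ⊢
        have : (1/(32*d):ℝ) * (2*p) = (p:ℝ)/d * (1/16) := by
          have : (d:ℝ) ≠ 0 := by positivity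
          field_simp; ring
        rw [this]
        exact mul_le_mul_of_nonneg_right h1 (by norm_num)
    _ = _ := by rw [Real.rpow_mul (by norm_num), Real.rpow_natCast]

lemma mul_le_of_sq {a b M : ℝ} (ha : a^2 ≤ M) (hb : b^2 ≤ M) : a * b ≤ M := by
  nlinarith [sq_nonneg (a-b)]

lemma step_bd (hd : 2 ≤ d) (t1 : ℝ) (ht1 : 0 < t1) : ∃ C : ℝ, 0 < C ∧ ∀ (θ : ℝ) (μ ν : List Bool → ℝ), IsFr θ μ → IsFr θ ν →
    2 * θ ≤ ((1/2:ℝ)^(1/(32*d):ℝ))⁻¹ → ∀ t, t1 ≤ t → ∀ p,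
    |inner ℝ (AA t (uu (show 0 < d by omega) μ (p+1))) (uu (show 0 < d by omega) ν (p+1))
      - inner ℝ (AA t (uu (show 0 < d by omega) μ p)) (uu (show 0 < d by omega) ν p)| ≤ C * ((1/2:ℝ)^(1/(32*d):ℝ))^p := by
  have hd0 : 0 < d := by omega
  obtain ⟨C, hC, hop⟩ := op_decay hd t1 ht1
  set q := (1/2:ℝ)^(1/(32*d):ℝ) with hq
  have hq0 : 0 < q := by positivity
  have hq1 : q ≤ 1 := Real.rpow_le_one (by norm_num) (by norm_num) (by positivity)
  refine ⟨2 * C / q, by positivity, ?_⟩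
  intro θ μ ν hμ hν hθ t ht p
  have hθ0 : 0 ≤ 2*θ := by
    have := (hμ.nn [true]).trans (hμ.le _)
    simp at this; linarith
  have hM : ∀ n, n ≤ p+1 → (2*θ)^n ≤ (q⁻¹)^(p+1) := fun n hn =>
    (pow_le_pow_left₀ hθ0 hθ n).trans (pow_le_pow_right₀ ((one_le_inv₀ hq0).2 hq1) hn)
  have hsh : |(-shL d p hd0)| = shL d p hd0 := by rw [abs_neg, abs_of_pos (shL_pos p hd0)]
  have hdec : ∀ ν, IsFr θ ν → ‖AA t (uu hd0 ν (p+1) - uu hd0 ν p)‖ ≤ C * q^(2*p) * ‖gg hd0 ν p‖ := by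
    intro ν hν
    rw [uu_succ hd0 hν]
    refine (hop tr tr_add tr_cont t ht (gg hd0 ν p) ⟨p % d, Nat.mod_lt _ hd0⟩ (-shL d p hd0) ?_).trans ?_
    · rw [hsh]; exact (shL_le p hd0).trans (pow_le_one₀ (by norm_num) (by norm_num))
    · rw [hsh]
      gcongr
      exact shL_rpow hd0 p
  have key : ∀ (ν ν' : List Bool → ℝ), IsFr θ ν → IsFr θ ν' → ∀ n, n ≤ p+1 →
      |inner ℝ (AA t (uu hd0 ν (p+1) - uu hd0 ν p)) (uu hd0 ν' n)| ≤ C * q^(2*p) * (q⁻¹)^(p+1) := by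
    intro ν ν' hν hν' n hn
    refine (abs_real_inner_le_norm _ _).trans ?_
    refine (mul_le_mul_of_nonneg_right (hdec ν hν) (norm_nonneg _)).trans ?_
    rw [mul_assoc (C * q^(2*p))]
    apply mul_le_mul_of_nonneg_left _ (by positivity)
    exact mul_le_of_sq ((gg_norm hd0 hν p).trans (hM p (by omega))) ((uu_norm hd0 hν' n).trans (hM n hn))
  have e : inner ℝ (AA t (uu hd0 μ (p+1))) (uu hd0 ν (p+1)) - inner ℝ (AA t (uu hd0 μ p)) (uu hd0 ν p)
      = inner ℝ (AA t (uu hd0 μ (p+1) - uu hd0 μ p)) (uu hd0 ν (p+1)) + inner ℝ (AA t (uu hd0 ν (p+1) - uu hd0 ν p)) (uu hd0 μ p) := by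
    rw [AA_symm t (uu hd0 ν (p+1) - uu hd0 ν p), real_inner_comm (AA t (uu hd0 μ p)), AA_sub, inner_sub_left, inner_sub_right]
    ring
  rw [e]
  refine (abs_add_le _ _).trans ?_
  have h1 := key μ ν hμ hν (p+1) le_rfl
  have h2 := key ν μ hν hμ p (by omega)
  have e2 : C * q^(2*p) * (q⁻¹)^(p+1) = C / q * q^p := by
    rw [inv_pow, pow_succ, two_mul, pow_add]; field_simp
  rw [e2] at h1 h2
  calc _ ≤ _ := add_le_add h1 h2
    _ = _ := by ring

lemma core_pos (hd : 2 ≤ d) : ∃ (t0 η : ℝ) (p0 : ℕ), 0 < t0 ∧ t0 ≤ 1 ∧ 0 < η ∧ η < 1 ∧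
    ∀ (θ : ℝ) (μ ν : List Bool → ℝ), IsFr θ μ → IsFr θ ν → 2 * θ ≤ 1 + η → 1 - η ≤ μ [] → 1 - η ≤ ν [] →
    ∀ t ∈ Icc (t0/2) t0, ∀ p, p0 ≤ p → ∃ z : Euc d, ‖z‖ = t ∧
      0 < inner ℝ (tr z (uu (show 0 < d by omega) μ p)) (uu (show 0 < d by omega) ν p) := by
  have hd0 : 0 < d := by omega
  obtain ⟨t0, ht0, ht01, hone⟩ := AA_one hd
  obtain ⟨C, hC, hstep⟩ := step_bd hd (t0/2) (by positivity)
  set q := (1/2:ℝ)^(1/(32*d):ℝ) with hq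
  have hq0 : 0 < q := by positivity
  have hq1 : q < 1 := Real.rpow_lt_one (by norm_num) (by norm_num) (by positivity)
  have hq2 : 0 < 1 - q := by linarith
  obtain ⟨p0, hp0⟩ := exists_pow_lt_of_lt_one (show 0 < (1-q)/(8*C) by positivity) hq1
  obtain ⟨η1, hη1, hη1'⟩ : ∃ η : ℝ, 0 < η ∧ (1+η)^p0 < 1 + 1/128 := by
    have hcont : ContinuousAt (fun η : ℝ => (1+η)^p0) 0 := by fun_prop
    have := hcont.eventually_lt (g := fun _ => 1 + 1/128) continuousAt_const (by norm_num)
    obtain ⟨δ, hδ, h⟩ := Metric.eventually_nhds_iff.1 this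
    exact ⟨δ/2, by positivity, h (by rw [dist_zero_right, Real.norm_eq_abs, abs_of_pos (by positivity)]; linarith)⟩
  have hqi : 0 < q⁻¹ - 1 := by
    have := (one_lt_inv₀ hq0).2 hq1
    linarith
  set η := min (min η1 (1/256)) (q⁻¹ - 1) with hη
  have hη0 : 0 < η := by positivity
  have hηa : η ≤ η1 := (min_le_left _ _).trans (min_le_left _ _)
  have hηb : η ≤ 1/256 := (min_le_left _ _).trans (min_le_right _ _)
  have hηc : η ≤ q⁻¹ - 1 := min_le_right _ _
  refine ⟨t0, η, p0, ht0, ht01, hη0, by linarith, ?_⟩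
  intro θ μ ν hμ hν hθ hμ1 hν1 t ht p hp
  have htpos : 0 < t := by linarith [ht.1]
  apply AA_pos hd t htpos
  have hθ0 : 0 ≤ 2*θ := by
    have := (hμ.nn [true]).trans (hμ.le _)
    simp at this; linarith
  have hpow : (2*θ)^p0 ≤ 1 + 1/128 := (pow_le_pow_left₀ hθ0 (hθ.trans (by linarith)) p0).trans hη1'.le
  have near : ∀ μ, IsFr θ μ → 1 - η ≤ μ [] → ‖uu hd0 μ p0 - ind hd0 []‖ ≤ 1/8 := by
    intro μ hμ h
    have := uu_near hd0 hμ p0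
    apply abs_le_of_sq_le_sq' _ (by norm_num) |>.2
    linarith
  have nrm : ∀ μ, IsFr θ μ → ‖uu hd0 μ p0‖ ≤ 9/8 := by
    intro μ hμ
    have := uu_norm hd0 hμ p0
    apply abs_le_of_sq_le_sq' _ (by norm_num) |>.2
    linarith
  have hn : ‖ind hd0 []‖ ≤ 1 := by
    have := norm_ind_sq hd0 []
    apply abs_le_of_sq_le_sq' _ (by norm_num) |>.2
    rw [this]; simp
  have base : 3/4 - 17/64 ≤ inner ℝ (AA t (uu hd0 μ p0)) (uu hd0 ν p0) := by
    have e : inner ℝ (AA t (uu hd0 μ p0)) (uu hd0 ν p0) = inner ℝ (AA t (ind hd0 [])) (ind hd0 [])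
       + inner ℝ (AA t (uu hd0 μ p0 - ind hd0 [])) (uu hd0 ν p0) + inner ℝ (AA t (ind hd0 [])) (uu hd0 ν p0 - ind hd0 []) := by
      rw [AA_sub, inner_sub_left, inner_sub_right]; ring
    have h1 := hone t htpos ht.2
    have h2 : |inner ℝ (AA t (uu hd0 μ p0 - ind hd0 [])) (uu hd0 ν p0)| ≤ 1/8 * (9/8) :=
      (abs_real_inner_le_norm _ _).trans (mul_le_mul ((AA_norm t _).trans (near μ hμ hμ1)) (nrm ν hν) (norm_nonneg _) (by norm_num))
    have h3 : |inner ℝ (AA t (ind hd0 [])) (uu hd0 ν p0 - ind hd0 [])| ≤ 1 * (1/8) :=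
      (abs_real_inner_le_norm _ _).trans (mul_le_mul ((AA_norm t _).trans hn) (near ν hν hν1) (norm_nonneg _) (by norm_num))
    rw [e]
    have h2' := (abs_le.1 h2).1
    have h3' := (abs_le.1 h3).1
    linarith
  have hind : ∀ k, inner ℝ (AA t (uu hd0 μ p0)) (uu hd0 ν p0) - C * (q^p0 - q^(p0+k)) / (1-q) ≤ inner ℝ (AA t (uu hd0 μ (p0+k))) (uu hd0 ν (p0+k)) := by
    intro k
    induction k with
    | zero => simp
    | succ k ih =>
      have h1 := hstep θ μ ν hμ hν (hθ.trans (by linarith)) t ht.1 (p0+k)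
      have h1' := (abs_le.1 h1).1
      have e : C * (q^p0 - q^(p0+(k+1))) / (1-q) = C * (q^p0 - q^(p0+k)) / (1-q) + C * q^(p0+k) := by
        have : 1 - q ≠ 0 := by linarith
        rw [← add_assoc, pow_succ]; field_simp; ring
      rw [e]
      rw [← add_assoc]
      linarith
  obtain ⟨k, rfl⟩ := Nat.exists_eq_add_of_le hp
  have h1 := hind k
  have h2 : C * (q^p0 - q^(p0+k)) / (1-q) ≤ 1/8 := by
    rw [div_le_iff₀ (by linarith)]
    rw [lt_div_iff₀ (by positivity)] at hp0
    have : 0 ≤ C * q^(p0+k) := by positivity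
    nlinarith
  linarith

end

section
variable {d : ℕ}

lemma baire_cpt (n m : ℕ → ℕ) (α β : ℕ → ℕ → ℕ) (hα : ∀ k, ∀ i < k, α k i ≤ n i) (hβ : ∀ k, ∀ i < k, β k i ≤ m i) :
    ∃ (a b : ℕ → ℕ) (φ : ℕ → ℕ), StrictMono φ ∧ Tendsto (fun k => α (φ k)) atTop (𝓝 a) ∧ Tendsto (fun k => β (φ k)) atTop (𝓝 b) := by
  have hcpt : ∀ n : ℕ → ℕ, IsCompact (Set.pi univ fun i => Iic (n i)) := fun n =>
    isCompact_univ_pi fun i => (Set.finite_Iic (n i)).isCompact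
  obtain ⟨⟨a, b⟩, -, φ, hφ, hlim⟩ := ((hcpt n).prod (hcpt m)).tendsto_subseq
    (x := fun k => ((fun i => min (α k i) (n i)), (fun i => min (β k i) (m i))))
    (fun k => ⟨fun i _ => mem_Iic.2 (min_le_right (α k i) (n i)), fun i _ => mem_Iic.2 (min_le_right (β k i) (m i))⟩)
  refine ⟨a, b, φ, hφ, ?_, ?_⟩
  · have h1 := (continuous_fst.tendsto _).comp hlim
    rw [tendsto_pi_nhds] at h1 ⊢
    intro i
    refine (h1 i).congr' ?_
    filter_upwards [eventually_gt_atTop i] with k hk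
    exact min_eq_left (hα _ i (hk.trans_le (hφ.id_le k)))
  · have h1 := (continuous_snd.tendsto _).comp hlim
    rw [tendsto_pi_nhds] at h1 ⊢
    intro i
    refine (h1 i).congr' ?_
    filter_upwards [eventually_gt_atTop i] with k hk
    exact min_eq_left (hβ _ i (hk.trans_le (hφ.id_le k)))

lemma core (hd : 2 ≤ d) : ∃ (t0 η : ℝ), 0 < t0 ∧ t0 ≤ 1 ∧ 0 < η ∧ η < 1 ∧
    ∀ θ : ℝ, 0 < θ → θ ≤ 1 → 2 * θ ≤ 1 + η → ∀ E F : Set (Euc d), MeasurableSet E → MeasurableSet F →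
    ENNReal.ofReal (1 - η) < HH (bx d) (ENNReal.ofReal θ) [] E → ENNReal.ofReal (1 - η) < HH (bx d) (ENNReal.ofReal θ) [] F →
    Icc (t0/2) t0 ⊆ distSet E F := by
  have hd0 : 0 < d := by omega
  obtain ⟨t0, η, p0, ht0, ht01, hη, hη1, hcore⟩ := core_pos hd
  refine ⟨t0, η, ht0, ht01, hη, hη1, ?_⟩
  intro θ hθ0 hθ1 hθ E F hE hF hhE hhF t ht
  have hb := bx_tree hd0
  have hne : ∀ E : Set (Euc d), ENNReal.ofReal (1 - η) < HH (bx d) (ENNReal.ofReal θ) [] E → E ≠ ∅ := by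
    rintro E h rfl
    rw [HH_empty [] (empty_inter _)] at h
    exact not_lt_zero h
  have han : ∀ E : Set (Euc d), MeasurableSet E → E ≠ ∅ → ∃ f : (ℕ → ℕ) → Euc d, Continuous f ∧ range f = E := by
    intro E hE hne
    have := hE.analyticSet
    rw [AnalyticSet] at this
    exact this.resolve_left hne
  obtain ⟨f, hf, rfl⟩ := han E hE (hne E hhE)
  obtain ⟨g, hg, rfl⟩ := han F hF (hne F hhF)
  have hθe0 : ENNReal.ofReal θ ≠ 0 := by simpa using hθ0
  have hθe1 : ENNReal.ofReal θ ≤ 1 := by simpa using hθ1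
  obtain ⟨n, hn⟩ := souslin_choose hb hθe0 hθe1 f _ hhE
  obtain ⟨m, hm⟩ := souslin_choose hb hθe0 hθe1 g _ hhF
  have key : ∀ k, ∃ α β : ℕ → ℕ, (∀ i < k, α i ≤ n i) ∧ (∀ i < k, β i ≤ m i) ∧ |dist (f α) (g β) - t| ≤ 2 * (d * (1/2)^((p0 + k)/d)) := by
    intro k
    have fr : ∀ A : Set (Euc d), ENNReal.ofReal (1 - η) < HH (bx d) (ENNReal.ofReal θ) [] A →
        ∃ μ, IsFr θ μ ∧ 1 - η ≤ μ [] ∧ (∀ v, 0 < μ v → (A ∩ bx d v).Nonempty) := by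
      intro A hA
      obtain ⟨μ, h1, h2, h3, h4, h5⟩ := frostman hb hθe1 A
      rw [ENNReal.toReal_ofReal hθ0.le] at h2
      refine ⟨μ, ⟨h1, h2, h3⟩, ?_, h5⟩
      rw [h4]
      exact (ENNReal.ofReal_le_iff_le_toReal (ne_top_of_le_ne_top (wt_ne_top hθe1 _) (HH_le_wt _ _))).1 hA.le
    obtain ⟨μ, hμ, hμ1, hμ2⟩ := fr _ (hn k)
    obtain ⟨ν, hν, hν1, hν2⟩ := fr _ (hm k)
    obtain ⟨z, hz, hpos⟩ := hcore θ μ ν hμ hν hθ hμ1 hν1 t ht (p0 + k) (by omega)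
    obtain ⟨v, w, hv, hw, hv0, hw0, x, hx1, hx2⟩ := overlap hd0 hμ hν _ z hpos
    obtain ⟨_, ⟨α, hα, rfl⟩, hα2⟩ := hμ2 v hv0
    obtain ⟨_, ⟨β, hβ, rfl⟩, hβ2⟩ := hν2 w hw0
    refine ⟨α, β, hα, hβ, ?_⟩
    have h1 := bx_dist v _ _ hα2 hx1
    have h2 := bx_dist w _ _ hβ2 hx2
    rw [hv] at h1
    rw [hw] at h2
    have h3 : dist (x + z) x = t := by rw [dist_eq_norm, add_sub_cancel_left, hz]
    have h4 := dist_triangle4 (f α) (x+z) x (g β)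
    have h5 := dist_triangle4 (x+z) (f α) (g β) x
    rw [dist_comm x (g β)] at h4
    rw [dist_comm (x+z) (f α)] at h5
    rw [abs_le]; constructor <;> linarith
  choose α β hα hβ hdist using key
  obtain ⟨a, b, φ, hφ, ha, hb'⟩ := baire_cpt n m α β hα hβ
  refine ⟨f a, mem_range_self a, g b, mem_range_self b, ?_⟩
  have l1 : Tendsto (fun k => dist (f (α (φ k))) (g (β (φ k)))) atTop (𝓝 (dist (f a) (g b))) :=
    ((hf.tendsto a).comp ha).dist ((hg.tendsto b).comp hb')
  have l2 : Tendsto (fun k => dist (f (α (φ k))) (g (β (φ k)))) atTop (𝓝 t) := by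
    have l3 : Tendsto (fun k => 2 * ((d:ℝ) * (1/2)^((p0 + φ k)/d))) atTop (𝓝 0) := by
      have h1 : Tendsto (fun k => (p0 + φ k)/d) atTop atTop := by
        apply (Nat.tendsto_div_const_atTop hd0.ne').comp
        exact tendsto_atTop_mono (fun k => Nat.le_add_left _ _) hφ.tendsto_atTop
      have h2 := (tendsto_pow_atTop_nhds_zero_of_lt_one (show (0:ℝ) ≤ 1/2 by norm_num) (by norm_num)).comp h1
      have := (h2.const_mul (d:ℝ)).const_mul 2
      simpa using this
    rw [tendsto_iff_dist_tendsto_zero]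
    refine squeeze_zero (fun k => dist_nonneg) (fun k => ?_) l3
    rw [Real.dist_eq]; exact hdist _
  exact tendsto_nhds_unique l1 l2

end

section
variable {d : ℕ} {s : ℝ}

lemma DC_le {E : Set (Euc d)} (Q : ℕ → Set (Euc d)) (l : ℕ → ℝ) (h : ∀ i, IsDyadicCube (Q i) (l i)) (hE : E ⊆ ⋃ i, Q i) :
    dyadicContent s E ≤ ∑' i, ENNReal.ofReal (l i ^ s) :=
  iInf_le_of_le Q (iInf_le_of_le l (iInf_le_of_le h (iInf_le_of_le hE le_rfl)))

lemma DC_exists {E : Set (Euc d)} {c : ℝ≥0∞} (h : dyadicContent s E < c) : ∃ (Q : ℕ → Set (Euc d)) (l : ℕ → ℝ),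
    (∀ i, IsDyadicCube (Q i) (l i)) ∧ E ⊆ ⋃ i, Q i ∧ ∑' i, ENNReal.ofReal (l i ^ s) < c := by
  unfold dyadicContent at h
  simp only [iInf_lt_iff] at h
  obtain ⟨Q, l, h1, h2, h3⟩ := h
  exact ⟨Q, l, h1, h2, h3⟩

lemma DC_mono {E F : Set (Euc d)} (h : E ⊆ F) : dyadicContent s E ≤ dyadicContent s F := by
  refine le_iInf fun Q => le_iInf fun l => le_iInf fun h1 => le_iInf fun h2 => ?_
  exact DC_le Q l h1 (h.trans h2)

lemma dy_pos {Q : Set (Euc d)} {l : ℝ} (h : IsDyadicCube Q l) : 0 < l := by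
  obtain ⟨k, m, rfl, -⟩ := h; positivity

lemma tiny (hs : 0 < s) (ε : ℝ≥0) (hε : 0 < ε) : ∃ (Q : Set (Euc d)) (l : ℝ), IsDyadicCube Q l ∧ ENNReal.ofReal (l ^ s) ≤ ε := by
  have hr : (1/2:ℝ)^s < 1 := Real.rpow_lt_one (by norm_num) (by norm_num) hs
  obtain ⟨n, hn⟩ := exists_pow_lt_of_lt_one (show (0:ℝ) < ε by exact_mod_cast hε) hr
  refine ⟨_, _, ⟨n, 0, rfl, rfl⟩, ?_⟩
  rw [← ENNReal.ofReal_coe_nnreal]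
  apply ENNReal.ofReal_le_ofReal
  have : ((2:ℝ)^(-(n:ℤ)))^s = ((1/2:ℝ)^s)^n := by
    rw [zpow_neg, zpow_natCast, ← inv_pow, ← Real.rpow_natCast, ← Real.rpow_natCast, ← Real.rpow_mul (by norm_num), ← Real.rpow_mul (by norm_num), mul_comm]
    norm_num
  rw [this]; exact hn.le

lemma DC_cube (hs : 0 < s) {E Q : Set (Euc d)} {l : ℝ} (h : IsDyadicCube Q l) (hE : E ⊆ Q) : dyadicContent s E ≤ ENNReal.ofReal (l ^ s) := by
  apply ENNReal.le_of_forall_pos_le_add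
  intro ε hε _
  obtain ⟨ε', hε', hsum⟩ := ENNReal.exists_pos_sum_of_countable (ε := ε) (by exact_mod_cast hε.ne') ℕ
  choose Q' l' h1 h2 using fun i => tiny (d := d) hs (ε' i) (hε' i)
  refine (DC_le (fun i => Nat.casesOn i Q Q') (fun i => Nat.casesOn i l l') ?_ ?_).trans ?_
  · intro i; cases i
    · exact h
    · exact h1 _
  · exact hE.trans (subset_iUnion (fun i : ℕ => (Nat.casesOn i Q Q' : Set (Euc d))) 0)
  · rw [tsum_eq_zero_add' ENNReal.summable]
    exact add_le_add le_rfl ((ENNReal.tsum_le_tsum h2).trans hsum.le)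

lemma DC_empty (hs : 0 < s) : dyadicContent s (∅ : Set (Euc d)) = 0 := by
  apply le_antisymm _ (zero_le)
  apply ENNReal.le_of_forall_pos_le_add
  intro ε hε _
  obtain ⟨Q, l, h1, h2⟩ := tiny (d := d) hs ε hε
  rw [zero_add]
  exact (DC_cube hs h1 (empty_subset _)).trans h2

lemma DC_iUnion {ι : Type} [Countable ι] [Nonempty ι] (E : ι → Set (Euc d)) : dyadicContent s (⋃ i, E i) ≤ ∑' i, dyadicContent s (E i) := by
  apply ENNReal.le_of_forall_pos_le_add
  intro ε hε hfin
  obtain ⟨ε', hε', hsum⟩ := ENNReal.exists_pos_sum_of_countable (ε := ε) (by exact_mod_cast hε.ne') ι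
  have hlt : ∀ i, dyadicContent s (E i) < dyadicContent s (E i) + ε' i := fun i =>
    ENNReal.lt_add_right (ENNReal.ne_top_of_tsum_ne_top hfin.ne i) (by exact_mod_cast (hε' i).ne')
  choose Q l h1 h2 h3 using fun i => DC_exists (hlt i)
  obtain ⟨den⟩ := nonempty_denumerable (ι × ℕ)
  let e : ℕ ≃ ι × ℕ := (Denumerable.eqv (ι × ℕ)).symm
  refine (DC_le (fun n => Q (e n).1 (e n).2) (fun n => l (e n).1 (e n).2) (fun n => h1 _ _) ?_).trans ?_
  · refine iUnion_subset fun i x hx => ?_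
    obtain ⟨j, hj⟩ := mem_iUnion.1 (h2 i hx)
    exact mem_iUnion.2 ⟨e.symm (i, j), by simpa using hj⟩
  · rw [e.tsum_eq (fun p : ι × ℕ => ENNReal.ofReal (l p.1 p.2 ^ s)), ENNReal.tsum_prod (f := fun i j => ENNReal.ofReal (l i j ^ s))]
    refine (ENNReal.tsum_le_tsum fun i => (h3 i).le).trans ?_
    rw [ENNReal.tsum_add]
    gcongr

lemma DC_union (E F : Set (Euc d)) : dyadicContent s (E ∪ F) ≤ dyadicContent s E + dyadicContent s F := by
  rw [union_eq_iUnion]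
  refine (DC_iUnion _).trans ?_
  rw [tsum_fintype]; simp

lemma DC_exp {s1 : ℝ} (hs1 : 0 < s1) (h : s1 ≤ s) {c : ℝ≥0∞} (hc : c ≤ 1) {E : Set (Euc d)} (hE : c ≤ dyadicContent s E) :
    c ≤ dyadicContent s1 E := by
  by_contra hcon
  push Not at hcon
  obtain ⟨Q, l, h1, h2, h3⟩ := DC_exists hcon
  have : dyadicContent s E < c := by
    refine (DC_le Q l h1 h2).trans_lt (lt_of_le_of_lt ?_ h3)
    apply ENNReal.tsum_le_tsum
    intro i
    apply ENNReal.ofReal_le_ofReal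
    have hl := dy_pos (h1 i)
    have h4 : ENNReal.ofReal (l i ^ s1) < 1 := ((ENNReal.le_tsum i).trans_lt h3).trans_le hc
    rw [ENNReal.ofReal_lt_one] at h4
    have h5 : l i ≤ 1 := by
      by_contra h6
      push Not at h6
      exact absurd h4 (not_lt.2 (Real.one_le_rpow h6.le hs1.le))
    exact Real.rpow_le_rpow_of_exponent_ge hl h5 h
  exact absurd hE (not_le.2 this)

lemma DC_scale (hs : 0 < s) (k : ℕ) (m : Fin d → ℤ) (A B : Set (Euc d)) (hA : A ⊆ bx d [])
    (h : ∀ y ∈ B, ∃ x ∈ A, ∀ i, y i = (2:ℝ)^(-(k:ℤ)) * (m i + x i)) :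
    dyadicContent s B ≤ ENNReal.ofReal (((2:ℝ)^(-(k:ℤ)))^s) * dyadicContent s A := by
  have hK : (0:ℝ) < ((2:ℝ)^(-(k:ℤ)))^s := by positivity
  rw [mul_comm, ← ENNReal.div_le_iff (by simpa using hK) ENNReal.ofReal_ne_top]
  refine le_iInf fun Q => le_iInf fun l => le_iInf fun h1 => le_iInf fun h2 => ?_
  rw [ENNReal.div_le_iff (by simpa using hK) ENNReal.ofReal_ne_top, mul_comm, ← ENNReal.tsum_mul_left]
  choose a b hl hQ using h1
  have h2k : (0:ℝ) < (2:ℝ)^(-(k:ℤ)) := by positivity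
  by_cases ha : ∃ n, a n ≤ 0
  · obtain ⟨n, hn⟩ := ha
    refine le_trans ?_ (ENNReal.le_tsum n)
    have h3 : (1:ℝ) ≤ l n ^ s := by
      apply Real.one_le_rpow _ hs.le
      rw [hl]
      exact one_le_zpow₀ (by norm_num) (by omega)
    refine (DC_cube hs ⟨k, m, rfl, rfl⟩ ?_).trans (le_mul_of_one_le_right zero_le ?_)
    · intro y hy i
      obtain ⟨x, hx, hxy⟩ := h y hy
      have h4 := hA hx
      rw [bx_nil] at h4
      have h5 := h4 i
      rw [hxy i]
      constructor <;> nlinarith [h5.1, h5.2]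
    · simpa using h3
  push Not at ha
  refine (DC_le (fun n => {x | ∀ i, ((b n i + m i * 2^(a n).toNat : ℤ) : ℝ) * (2:ℝ) ^ (-(k + a n)) ≤ x i ∧ x i ≤ (((b n i + m i * 2^(a n).toNat : ℤ) : ℝ) + 1) * (2:ℝ) ^ (-(k + a n))}) (fun n => (2:ℝ)^(-(k + a n))) ?_ ?_).trans ?_
  · intro n
    exact ⟨k + a n, fun i => b n i + m i * 2^(a n).toNat, rfl, rfl⟩
  · intro y hy
    obtain ⟨x, hx, hxy⟩ := h y hy
    obtain ⟨n, hn⟩ := mem_iUnion.1 (h2 hx)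
    refine mem_iUnion.2 ⟨n, fun i => ?_⟩
    rw [hQ n] at hn
    have h3 := hn i
    have e1 : (2:ℝ)^(-(k + a n)) = (2:ℝ)^(-(k:ℤ)) * (2:ℝ)^(-(a n)) := by
      rw [neg_add, zpow_add₀ (by norm_num)]
    have e2 : (2:ℝ)^(a n).toNat * (2:ℝ)^(-(a n)) = 1 := by
      rw [← zpow_natCast, Int.toNat_of_nonneg (ha n).le, ← zpow_add₀ (by norm_num)]; simp
    rw [hxy i, e1]
    push_cast
    have e3 : ((b n i : ℝ) + m i * 2^(a n).toNat) * ((2:ℝ)^(-(k:ℤ)) * (2:ℝ)^(-(a n))) = (2:ℝ)^(-(k:ℤ)) * (m i + b n i * (2:ℝ)^(-(a n))) := by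
      linear_combination (m i * (2:ℝ)^(-(k:ℤ))) * e2
    have e4 : ((b n i : ℝ) + m i * 2^(a n).toNat + 1) * ((2:ℝ)^(-(k:ℤ)) * (2:ℝ)^(-(a n))) = (2:ℝ)^(-(k:ℤ)) * (m i + (b n i + 1) * (2:ℝ)^(-(a n))) := by
      linear_combination (m i * (2:ℝ)^(-(k:ℤ))) * e2
    rw [e3, e4]
    exact ⟨mul_le_mul_of_nonneg_left (by linarith [h3.1]) h2k.le, mul_le_mul_of_nonneg_left (by linarith [h3.2]) h2k.le⟩
  · apply ENNReal.tsum_le_tsum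
    intro n
    rw [← ENNReal.ofReal_mul hK.le, hl, ← Real.mul_rpow (by positivity) (by positivity), neg_add, zpow_add₀ (by norm_num)]

/-- the tree parameter for exponent `s` -/
def th (d : ℕ) (s : ℝ) : ℝ := (2:ℝ)^(-s/d)

lemma th_pow (hd : 0 < d) (n : ℕ) : (th d s)^(d * n) = ((2:ℝ)^(-(n:ℤ)))^s := by
  unfold th
  have : (d:ℝ) ≠ 0 := by positivity
  rw [← Real.rpow_natCast, ← Real.rpow_mul (by norm_num), ← Real.rpow_intCast, ← Real.rpow_mul (by norm_num)]
  congr 1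
  push_cast; field_simp

lemma DC_bx (hd : 0 < d) (hs : 0 < s) (k : ℕ) (v : List Bool) (hv : d ∣ v.length + k) :
    dyadicContent s (bx d v) ≤ (2 * ENNReal.ofReal (th d s))^k * ENNReal.ofReal (th d s) ^ v.length := by
  induction k generalizing v with
  | zero =>
    obtain ⟨n, hn⟩ := hv
    rw [add_zero] at hn
    rw [pow_zero, one_mul, hn, ← ENNReal.ofReal_pow (by unfold th; positivity), th_pow hd]
    refine DC_cube hs ⟨n, bidx d v, rfl, rfl⟩ ?_
    intro x hx i
    have h1 := hx i
    rw [hn, ex_mul, Int.floor_eq_iff] at h1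
    rw [zpow_neg, zpow_natCast, ← div_eq_mul_inv, ← div_eq_mul_inv]
    have : (0:ℝ) < 2^n := by positivity
    rw [div_le_iff₀' this, le_div_iff₀' this]
    exact ⟨h1.1, h1.2.le⟩
  | succ k ih =>
    have h1 := ih (false :: v) (by rw [List.length_cons]; convert hv using 1; ring)
    have h2 := ih (true :: v) (by rw [List.length_cons]; convert hv using 1; ring)
    calc dyadicContent s (bx d v) ≤ dyadicContent s (bx d (false :: v) ∪ bx d (true :: v)) := DC_mono ((bx_tree hd).cov v)
      _ ≤ _ := DC_union _ _
      _ ≤ _ := add_le_add h1 h2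
      _ = _ := by simp only [List.length_cons, pow_succ]; ring

lemma DC_HH (hd : 0 < d) (hs : 0 < s) (hsd : s ≤ d) (E : Set (Euc d)) (hE : E ⊆ bx d []) :
    dyadicContent s E ≤ (2 * ENNReal.ofReal (th d s))^d * HH (bx d) (ENNReal.ofReal (th d s)) [] E := by
  have h1 : 1 ≤ 2 * ENNReal.ofReal (th d s) := by
    have : 1 ≤ 2 * th d s := by
      unfold th
      have : (2:ℝ)^(-1:ℝ) ≤ (2:ℝ)^(-s/d) := by
        apply Real.rpow_le_rpow_of_exponent_le (by norm_num)
        rw [neg_div, neg_le_neg_iff, div_le_one (by positivity)]; exact hsd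
      rw [Real.rpow_neg_one] at this
      linarith
    rw [← ENNReal.ofReal_ofNat, ← ENNReal.ofReal_mul (by norm_num)]
    exact ENNReal.one_le_ofReal.2 this
  have hne : 2 * ENNReal.ofReal (th d s) ≠ ⊤ := ENNReal.mul_ne_top (by norm_num) ENNReal.ofReal_ne_top
  have hbx : ∀ v : List Bool, dyadicContent s (bx d v) ≤ (2 * ENNReal.ofReal (th d s))^d * wt (ENNReal.ofReal (th d s)) v := by
    intro v
    obtain ⟨k, hk, hk2⟩ : ∃ k, k ≤ d ∧ d ∣ v.length + k := by
      refine ⟨d - v.length % d, by omega, v.length / d + 1, ?_⟩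
      have := Nat.div_add_mod v.length d
      have := Nat.mod_lt v.length hd
      rw [mul_add]; omega
    refine (DC_bx hd hs k v hk2).trans ?_
    unfold wt
    gcongr
  rw [mul_comm, ← ENNReal.div_le_iff (pow_ne_zero _ (by intro h; rw [h] at h1; simp at h1)) (ENNReal.pow_ne_top hne)]
  by_contra hcon
  push Not at hcon
  obtain ⟨S, hS1, hS2, hS3⟩ := HH_exists hcon
  refine absurd hS3 (not_lt.2 ?_)
  rw [ENNReal.div_le_iff (pow_ne_zero _ (by intro h; rw [h] at h1; simp at h1)) (ENNReal.pow_ne_top hne), mul_comm]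
  classical
  calc dyadicContent s E ≤ dyadicContent s (⋃ w : List Bool, if w ∈ S then bx d w else ∅) := by
        apply DC_mono
        intro x hx
        obtain ⟨w, hw, hxw⟩ := mem_iUnion₂.1 (hS2 ⟨hx, hE hx⟩)
        exact mem_iUnion.2 ⟨w, by rw [if_pos hw]; exact hxw⟩
    _ ≤ _ := DC_iUnion _
    _ ≤ _ := by
      unfold wsum
      rw [← ENNReal.tsum_mul_left]
      apply ENNReal.tsum_le_tsum
      intro w
      by_cases hw : w ∈ S
      · rw [if_pos hw, indicator_of_mem hw]; exact hbx w
      · rw [if_neg hw, DC_empty hs]; exact zero_le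

end

section
variable {d : ℕ} {s : ℝ}

/-- the rescaling map -/
def psi (k : ℕ) (m : Fin d → ℤ) (x : Euc d) : Euc d := ((2:ℝ)^(-(k:ℤ))) • (WithLp.toLp 2 (fun i => (m i : ℝ)) + x)

lemma psi_apply (k : ℕ) (m : Fin d → ℤ) (x : Euc d) (i : Fin d) : psi k m x i = (2:ℝ)^(-(k:ℤ)) * (m i + x i) := by
  simp [psi, mul_add]

lemma psi_dist (k : ℕ) (m : Fin d → ℤ) (x y : Euc d) : dist (psi k m x) (psi k m y) = (2:ℝ)^(-(k:ℤ)) * dist x y := by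
  unfold psi
  rw [dist_smul₀, dist_add_left, Real.norm_eq_abs, abs_of_pos (by positivity)]

lemma psi_meas (k : ℕ) (m : Fin d → ℤ) : Measurable (psi k m) := by
  apply Continuous.measurable; unfold psi; fun_prop

def piece (k : ℕ) (m : Fin d → ℤ) (E : Set (Euc d)) : Set (Euc d) := bx d [] ∩ psi k m ⁻¹' E

def mI {N : ℕ} (m : Fin d → Fin (N+1)) : Fin d → ℤ := fun i => ((m i : ℕ) : ℤ)

lemma DC_pieces (hs : 0 < s) (k : ℕ) (E : Set (Euc d)) (hE : E ⊆ unitCube d) : dyadicContent s E ≤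
    ∑ m : Fin d → Fin (2^k + 1), ENNReal.ofReal (((2:ℝ)^(-(k:ℤ)))^s) * dyadicContent s (piece k (mI m) E) := by
  have hcov : E ⊆ ⋃ m : Fin d → Fin (2^k+1), psi k (mI m) '' piece k (mI m) E := by
    intro y hy
    have hy1 := hE hy
    have hb : ∀ i, ⌊(2:ℝ)^k * y i⌋₊ < 2^k + 1 := by
      intro i
      rw [Nat.lt_add_one_iff]
      apply Nat.floor_le_of_le
      push_cast
      have := (hy1 i).2
      have h2 : (0:ℝ) < 2^k := by positivity
      nlinarith
    let m : Fin d → Fin (2^k+1) := fun i => ⟨⌊(2:ℝ)^k * y i⌋₊, hb i⟩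
    let x : Euc d := WithLp.toLp 2 (fun i => (2:ℝ)^k * y i - ⌊(2:ℝ)^k * y i⌋₊)
    have hxy : psi k (mI m) x = y := by
      ext i
      rw [psi_apply]
      simp only [mI, m, x]
      rw [zpow_neg, zpow_natCast]
      push_cast
      field_simp; ring
    refine mem_iUnion.2 ⟨m, x, ⟨?_, ?_⟩, hxy⟩
    · rw [bx_nil]
      intro c
      have h0 : 0 ≤ (2:ℝ)^k * y c := mul_nonneg (by positivity) (hy1 c).1
      have h1 := Nat.floor_le h0
      have h2 := Nat.lt_floor_add_one ((2:ℝ)^k * y c)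
      simp only [x]
      constructor <;> linarith
    · rw [mem_preimage, hxy]; exact hy
  refine (DC_mono hcov).trans ((DC_iUnion _).trans ?_)
  rw [tsum_fintype]
  apply Finset.sum_le_sum
  intro m _
  refine DC_scale hs k (mI m) _ _ inter_subset_left ?_
  rintro _ ⟨x, hx, rfl⟩
  exact ⟨x, hx, fun i => psi_apply _ _ _ _⟩

lemma DC_piece_le (hs : 0 < s) (k : ℕ) (m : Fin d → ℤ) (E : Set (Euc d)) : dyadicContent s (piece k m E) ≤ 1 := by
  refine (DC_cube hs ⟨0, 0, rfl, rfl⟩ ?_).trans (by simp)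
  intro x hx
  have := hx.1
  rw [bx_nil] at this
  intro i
  have := this i
  simp; exact ⟨this.1, this.2.le⟩

lemma pigeon (hd : 0 < d) (hs : 0 < s) (k : ℕ) (E F : Set (Euc d)) (hE : E ⊆ unitCube d) (hF : F ⊆ unitCube d) (ρ δ : ℝ) (hρ : ρ < 1) (hδ : δ < 1)
    (hδ0 : 0 < δ)
    (h1 : ENNReal.ofReal (1 - ρ) ≤ dyadicContent s E) (h2 : ENNReal.ofReal (1 - ρ) ≤ dyadicContent s F)
    (hK : ((2:ℝ)^(-(k:ℤ)))^s * (2^k+1)^d * (2 - δ) < 2 * (1 - ρ)) :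
    ∃ m : Fin d → ℤ, ENNReal.ofReal (1 - δ) ≤ dyadicContent s (piece k m E) ∧ ENNReal.ofReal (1 - δ) ≤ dyadicContent s (piece k m F) := by
  by_contra hcon
  push Not at hcon
  have hb : ∀ m, dyadicContent s (piece k m E) + dyadicContent s (piece k m F) ≤ ENNReal.ofReal (2 - δ) := by
    intro m
    have e : ENNReal.ofReal (2 - δ) = ENNReal.ofReal (1 - δ) + 1 := by
      rw [← ENNReal.ofReal_one, ← ENNReal.ofReal_add (by linarith) (by norm_num)]; congr 1; ring
    rw [e]
    rcases le_or_gt (ENNReal.ofReal (1 - δ)) (dyadicContent s (piece k m E)) with h | h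
    · rw [add_comm]; exact add_le_add (hcon m h).le (DC_piece_le hs _ _ _)
    · exact add_le_add h.le (DC_piece_le hs _ _ _)
  have h3 : ENNReal.ofReal (2 * (1 - ρ)) ≤ ENNReal.ofReal (((2:ℝ)^(-(k:ℤ)))^s * (2^k+1)^d * (2 - δ)) := by
    calc ENNReal.ofReal (2 * (1 - ρ)) = ENNReal.ofReal (1 - ρ) + ENNReal.ofReal (1 - ρ) := by
          rw [← ENNReal.ofReal_add (by linarith) (by linarith)]; congr 1; ring
      _ ≤ _ := add_le_add (h1.trans (DC_pieces hs k E hE)) (h2.trans (DC_pieces hs k F hF))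
      _ = ∑ m : Fin d → Fin (2^k + 1), ENNReal.ofReal (((2:ℝ)^(-(k:ℤ)))^s) * (dyadicContent s (piece k (mI m) E) + dyadicContent s (piece k (mI m) F)) := by
          rw [← Finset.sum_add_distrib]; simp_rw [mul_add]
      _ ≤ ∑ m : Fin d → Fin (2^k + 1), ENNReal.ofReal (((2:ℝ)^(-(k:ℤ)))^s) * ENNReal.ofReal (2 - δ) := by
          gcongr with m
          exact hb _
      _ = _ := by
          rw [Finset.sum_const, Finset.card_univ, Fintype.card_pi_const, Fintype.card_fin, nsmul_eq_mul, ← ENNReal.ofReal_natCast,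
            ← ENNReal.ofReal_mul (by positivity), ← ENNReal.ofReal_mul (by positivity)]
          congr 1
          push_cast; ring
  rw [ENNReal.ofReal_le_ofReal_iff (by
    have : 0 < ((2:ℝ)^(-(k:ℤ)))^s := by positivity
    have : 0 < 2 - δ := by linarith
    positivity)] at h3
  linarith

lemma main_part (hd : 2 ≤ d) (κ : ℝ) (hκ : 0 < κ) : ∃ ρκ : ℝ, 0 < ρκ ∧ ∀ ρ : ℝ, 0 < ρ → ρ ≤ ρκ →
          ∀ E F : Set (Euc d), MeasurableSet E → MeasurableSet F →
            E ⊆ unitCube d → F ⊆ unitCube d →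
            ∀ s : ℝ, (d : ℝ) - ρ / Real.log (1/ρ) ≤ s →
            ENNReal.ofReal (1 - ρ) ≤ dyadicContent s E →
            ENNReal.ofReal (1 - ρ) ≤ dyadicContent s F →
            Icc ρ (ρ ^ κ) ⊆ distSet E F := by
  have hd0 : 0 < d := by omega
  obtain ⟨t0, η, ht0, ht01, hη, hη1, hcore⟩ := core hd
  have hev : ∀ᶠ ρ : ℝ in 𝓝 0, ρ < Real.exp (-1) ∧ ρ^κ < t0 ∧
      (1 + 2 * ρ^κ / t0)^d * Real.exp ρ * (2 - η/2) < 2 * (1 - ρ) ∧ (2:ℝ)^ρ * (1-η) < 1 - η/2 ∧ (2:ℝ)^ρ < 1 + η := by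
    have cκ : ContinuousAt (fun ρ : ℝ => ρ^κ) 0 := Real.continuousAt_rpow_const _ _ (Or.inr hκ.le)
    have c2 : ContinuousAt (fun ρ : ℝ => (2:ℝ)^ρ) 0 := Real.continuousAt_const_rpow (by norm_num)
    have z : (0:ℝ)^κ = 0 := Real.zero_rpow hκ.ne'
    refine (continuousAt_id.eventually_lt continuousAt_const (by simpa using Real.exp_pos _)).and ?_
    refine (cκ.eventually_lt continuousAt_const (by simpa [z] using ht0)).and ?_
    refine (ContinuousAt.eventually_lt (f := fun ρ : ℝ => (1 + 2 * ρ^κ / t0)^d * Real.exp ρ * (2 - η/2)) (g := fun ρ => 2 * (1 - ρ)) ?_ (by fun_prop) (by simp [z]; linarith)).and ?_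
    · exact ((((continuousAt_const.mul cκ).div_const t0).const_add 1).pow d |>.mul Real.continuous_exp.continuousAt).mul continuousAt_const
    refine (ContinuousAt.eventually_lt (c2.mul continuousAt_const) continuousAt_const (by simp; linarith)).and ?_
    exact c2.eventually_lt continuousAt_const (by simpa using hη)
  obtain ⟨δ, hδ, hball⟩ := Metric.eventually_nhds_iff.1 hev
  refine ⟨δ/2, by positivity, ?_⟩
  intro ρ hρ hρδ E F hEm hFm hE hF s hs hcE hcF t ht
  obtain ⟨c1, c2, c3, c4, c5⟩ := hball (y := ρ) (by rw [dist_zero_right, Real.norm_eq_abs, abs_of_pos hρ]; linarith)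
  have hlog : 1 ≤ Real.log (1/ρ) := by
    rw [one_div, Real.log_inv, le_neg, ← Real.log_exp (-1)]
    exact Real.log_le_log hρ c1.le
  have hρ1 : ρ < 1 := c1.trans (by rw [Real.exp_lt_one_iff]; norm_num)
  set ε := ρ / Real.log (1/ρ) with hε
  have hε0 : 0 < ε := by positivity
  have hερ : ε ≤ ρ := div_le_self hρ.le hlog
  set s1 := (d:ℝ) - ε with hs1
  have hd2 : (2:ℝ) ≤ d := by exact_mod_cast hd
  have hs10 : 0 < s1 := by linarith
  have hcE1 := DC_exp hs10 hs (by simp; exact hρ.le) hcE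
  have hcF1 := DC_exp hs10 hs (by simp; exact hρ.le) hcF
  have htpos : 0 < t := hρ.trans_le ht.1
  have htt0 : t ≤ t0 := ht.2.trans c2.le
  obtain ⟨k, hk1, hk2⟩ := exists_nat_pow_near (show 1 ≤ t0/t by rwa [one_le_div htpos]) (show (1:ℝ) < 2 by norm_num)
  have hN : (0:ℝ) < 2^k := by positivity
  have hNle : (2:ℝ)^k ≤ 1/ρ := by
    refine hk1.trans ?_
    rw [div_le_div_iff₀ htpos hρ]
    nlinarith [ht.1]
  have hkε : ((2:ℝ)^k)^ε ≤ Real.exp ρ := by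
    calc ((2:ℝ)^k)^ε ≤ (1/ρ)^ε := Real.rpow_le_rpow hN.le hNle hε0.le
      _ = Real.exp ρ := by
        rw [Real.rpow_def_of_pos (by positivity), hε]
        congr 1; field_simp
  have hNinv : 1 + 1/(2:ℝ)^k ≤ 1 + 2 * ρ^κ / t0 := by
    rw [pow_succ, div_lt_iff₀ htpos] at hk2
    rw [add_le_add_iff_left, div_le_div_iff₀ hN ht0]
    nlinarith [ht.2]
  have hfac : ((2:ℝ)^(-(k:ℤ)))^s1 * (2^k+1)^d = (1 + 1/(2:ℝ)^k)^d * ((2:ℝ)^k)^ε := by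
    rw [zpow_neg, zpow_natCast, hs1, Real.rpow_sub (by positivity), Real.rpow_natCast, Real.inv_rpow hN.le ε]
    have : (1 + 1/(2:ℝ)^k) = (2^k+1)/2^k := by field_simp
    rw [this, div_pow, inv_pow]
    have : 0 < ((2:ℝ)^k)^ε := by positivity
    field_simp
  have hK : ((2:ℝ)^(-(k:ℤ)))^s1 * (2^k+1)^d * (2 - η/2) < 2 * (1 - ρ) := by
    refine lt_of_le_of_lt ?_ c3
    rw [hfac]
    apply mul_le_mul_of_nonneg_right _ (by linarith)
    gcongr
  obtain ⟨m, hm1, hm2⟩ := pigeon hd0 hs10 k E F hE hF ρ (η/2) hρ1 (by linarith) (by linarith) hcE1 hcF1 hK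
  have hth0 : 0 < th d s1 := by unfold th; positivity
  have h2th : 2 * th d s1 = (2:ℝ)^(ε/d) := by
    unfold th
    have : (2:ℝ) * 2^(-s1/d) = 2^(1:ℝ) * 2^(-s1/d) := by simp
    rw [this, ← Real.rpow_add (by norm_num)]
    congr 1
    rw [hs1]; field_simp; ring
  have hHH : ∀ E, ENNReal.ofReal (1 - η/2) ≤ dyadicContent s1 (piece k m E) →
      ENNReal.ofReal (1 - η) < HH (bx d) (ENNReal.ofReal (th d s1)) [] (piece k m E) := by
    intro E hE
    have h1 := hE.trans (DC_HH hd0 hs10 (by linarith) _ inter_subset_left)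
    by_contra hcon
    push Not at hcon
    have h2 := h1.trans (mul_le_mul_right hcon _)
    have e : (2 * ENNReal.ofReal (th d s1))^d = ENNReal.ofReal ((2:ℝ)^ε) := by
      rw [← ENNReal.ofReal_ofNat, ← ENNReal.ofReal_mul (by norm_num), h2th, ← ENNReal.ofReal_pow (by positivity), ← Real.rpow_natCast,
        ← Real.rpow_mul (by norm_num)]
      congr 2; field_simp
    rw [e, ← ENNReal.ofReal_mul (by positivity), ENNReal.ofReal_le_ofReal_iff (mul_nonneg (by positivity) (by linarith))] at h2
    have h3 : (2:ℝ)^ε ≤ 2^ρ := Real.rpow_le_rpow_of_exponent_le (by norm_num) hερ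
    have h4 : (2:ℝ)^ε * (1-η) ≤ 2^ρ * (1-η) := mul_le_mul_of_nonneg_right h3 (by linarith)
    linarith
  have hmeas : ∀ E : Set (Euc d), MeasurableSet E → MeasurableSet (piece k m E) := fun E hE =>
    (bx_meas []).inter (psi_meas k m hE)
  have hfin := hcore (th d s1) hth0 ?_ ?_ (piece k m E) (piece k m F) (hmeas E hEm) (hmeas F hFm) (hHH E hm1) (hHH F hm2)
    (show 2^k * t ∈ Icc (t0/2) t0 from ?_)
  · obtain ⟨x, hx, y, hy, hxy⟩ := hfin
    refine ⟨psi k m x, hx.2, psi k m y, hy.2, ?_⟩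
    rw [psi_dist, hxy, zpow_neg, zpow_natCast]; field_simp
  · unfold th
    apply Real.rpow_le_one_of_one_le_of_nonpos (by norm_num)
    rw [neg_div, neg_nonpos]; positivity
  · rw [h2th]
    refine le_trans ?_ c5.le
    apply Real.rpow_le_rpow_of_exponent_le (by norm_num)
    exact (div_le_self hε0.le (by linarith)).trans hερ
  · rw [le_div_iff₀ htpos] at hk1
    rw [pow_succ, div_lt_iff₀ htpos] at hk2
    constructor <;> linarith

end

/-- Theorem 1.2(b): for `d ≥ 2` there exists `ρ_d ∈ (0,1)` such that for every
`ρ ∈ (0, ρ_d]` there are positive `a_ρ, b_ρ, ε_ρ` such that for all Borel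
`E, F ⊆ [0,1]^d` and all `s ≥ d - ε_ρ`, if `min{H^s_∞(E), H^s_∞(F)} ≥ 1 - ρ`,
then `Δ(E,F) ⊇ [a_ρ, b_ρ]`.  Moreover there is a dimensional constant `c₀ > 0`
such that for any `κ ∈ (0,1)`, for all sufficiently small `ρ` one can take
`a_ρ = ρ^{c₀}`, `b_ρ = ρ^{c₀ κ}`, `ε_ρ = c₀ ρ / log(1/ρ)`. -/
theorem statement2 (d : ℕ) (hd : 2 ≤ d) :
    ∃ ρd : ℝ, ρd ∈ Ioo (0:ℝ) 1 ∧
      (∀ ρ : ℝ, ρ ∈ Ioc (0:ℝ) ρd →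
        ∃ a b ε : ℝ, 0 < a ∧ 0 < b ∧ 0 < ε ∧
          ∀ E F : Set (Euc d), MeasurableSet E → MeasurableSet F →
            E ⊆ unitCube d → F ⊆ unitCube d →
            ∀ s : ℝ, (d : ℝ) - ε ≤ s →
            ENNReal.ofReal (1 - ρ) ≤ dyadicContent s E →
            ENNReal.ofReal (1 - ρ) ≤ dyadicContent s F →
            Icc a b ⊆ distSet E F) ∧
      (∃ c₀ : ℝ, 0 < c₀ ∧ ∀ κ : ℝ, κ ∈ Ioo (0:ℝ) 1 →
        ∃ ρκ : ℝ, 0 < ρκ ∧ ∀ ρ : ℝ, 0 < ρ → ρ ≤ ρκ → ρ ≤ ρd →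
          ∀ E F : Set (Euc d), MeasurableSet E → MeasurableSet F →
            E ⊆ unitCube d → F ⊆ unitCube d →
            ∀ s : ℝ, (d : ℝ) - c₀ * ρ / Real.log (1/ρ) ≤ s →
            ENNReal.ofReal (1 - ρ) ≤ dyadicContent s E →
            ENNReal.ofReal (1 - ρ) ≤ dyadicContent s F →
            Icc (ρ ^ c₀) (ρ ^ (c₀ * κ)) ⊆ distSet E F) := by
  have part2 : ∀ κ : ℝ, 0 < κ → ∃ ρκ : ℝ, 0 < ρκ ∧ ∀ ρ : ℝ, 0 < ρ → ρ ≤ ρκ →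
          ∀ E F : Set (Euc d), MeasurableSet E → MeasurableSet F →
            E ⊆ unitCube d → F ⊆ unitCube d →
            ∀ s : ℝ, (d : ℝ) - 1 * ρ / Real.log (1/ρ) ≤ s →
            ENNReal.ofReal (1 - ρ) ≤ dyadicContent s E →
            ENNReal.ofReal (1 - ρ) ≤ dyadicContent s F →
            Icc (ρ ^ (1:ℝ)) (ρ ^ (1 * κ)) ⊆ distSet E F := by
    intro κ hκ
    obtain ⟨ρκ, h0, h⟩ := main_part hd κ hκ
    refine ⟨ρκ, h0, ?_⟩
    intro ρ hρ hρ1 E F hE hF hE1 hF1 s hs h1 h2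
    rw [one_mul] at hs
    rw [Real.rpow_one, one_mul]
    exact h ρ hρ hρ1 E F hE hF hE1 hF1 s hs h1 h2
  obtain ⟨r, hr0, hr⟩ := part2 (1/2) (by norm_num)
  refine ⟨min r (1/2), ⟨by positivity, (min_le_right _ _).trans_lt (by norm_num)⟩, ?_, ?_⟩
  · intro ρ hρ
    have hρ1 : ρ ≤ 1/2 := hρ.2.trans (min_le_right _ _)
    have hρ0 : 0 < ρ := hρ.1
    have hlog : 0 < Real.log (1/ρ) := by
      apply Real.log_pos
      rw [lt_div_iff₀ hρ0]; linarith
    exact ⟨ρ ^ (1:ℝ), ρ ^ (1 * (1/2 : ℝ)), 1 * ρ / Real.log (1/ρ), by positivity, by positivity, by positivity,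
      hr ρ hρ0 (hρ.2.trans (min_le_left _ _))⟩
  · refine ⟨1, one_pos, fun κ hκ => ?_⟩
    obtain ⟨ρκ, h0, h⟩ := part2 κ hκ.1
    exact ⟨ρκ, h0, fun ρ hρ hρ1 _ => h ρ hρ hρ1⟩
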